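/- arXiv:0806.3590 — 2 statements merged into one kernel-verified Lean document; each statement's English description precedes it below -/
import Mathlib

section
/- For each pair (b,c) ∈ {(1,2),(1,4),(2,2)}, the four-dimensional lattice sum F(b,c) equals the corresponding two-dimensional sum: the box limit defining F(1,2) exists and F(1,2) = Σ_{n∈ℤ} Σ_{k=0}^∞ (−1)^{n+k}(2k+1)/((2k+1)² + 4n²)²; the box limit defining F(1,4) exists and F(1,4) = 25 Σ_{n∈ℤ} Σ_{k∈ℤ} (−1)^n (3k+1)/(4(3k+1)² + (6n+1)²)²; and the box limit defining F(2,2) exists and F(2,2) = 9 Σ_{n=0}^∞ Σ_{k=0}^∞ (−1)^{n(n+1)/2+k}(2k+1)/(2(2k+1)² + (2n+1)²)². (The two-dimensional sums on the right are absolutely convergent.) -/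
open Real Filter Topology

/-- The partial "box" sum appearing in the definition of the lattice sum `F(a,b,c,d)`. -/
noncomputable def boxSum (a b c d : ℝ) (v : ℕ) : ℝ :=
  ∑ n₁ ∈ Finset.Icc (-(v:ℤ)) (v:ℤ), ∑ n₂ ∈ Finset.Icc (-(v:ℤ)) (v:ℤ),
    ∑ n₃ ∈ Finset.Icc (-(v:ℤ)) (v:ℤ), ∑ n₄ ∈ Finset.Icc (-(v:ℤ)) (v:ℤ),
      (-1:ℝ)^(n₁+n₂+n₃+n₄) /
        (a*((6*n₁+1:ℤ):ℝ)^2 + b*((6*n₂+1:ℤ):ℝ)^2 + c*((6*n₃+1:ℤ):ℝ)^2 + d*((6*n₄+1:ℤ):ℝ)^2)^2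

noncomputable def f12term (p : ℤ × ℕ) : ℝ :=
  (-1:ℝ)^(p.1 + (p.2:ℤ)) * (2*(p.2:ℝ)+1) / ((2*(p.2:ℝ)+1)^2 + 4*(p.1:ℝ)^2)^2

noncomputable def f14term (p : ℤ × ℤ) : ℝ :=
  (-1:ℝ)^(p.1) * (3*(p.2:ℝ)+1) / (4*(3*(p.2:ℝ)+1)^2 + (6*(p.1:ℝ)+1)^2)^2

noncomputable def f22term (p : ℕ × ℕ) : ℝ :=
  (-1:ℝ)^(p.1*(p.1+1)/2 + p.2) * (2*(p.2:ℝ)+1) / (2*(2*(p.2:ℝ)+1)^2 + (2*(p.1:ℝ)+1)^2)^2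

/-- The finite `q`-Pochhammer symbol `(q; q)_n`. -/
noncomputable def qFactorial (q : ℝ) (n : ℕ) : ℝ := ∏ i ∈ Finset.range n, (1 - q ^ (i + 1))

/-- Euler's product `(q; q)_∞`. -/
noncomputable def eulerProd (q : ℝ) : ℝ := ∏' i : ℕ, (1 - q ^ (i + 1))

/-- The reciprocal of `(q; q)_m`, extended by zero to negative `m`. -/
noncomputable def qFactorialInv (q : ℝ) (m : ℤ) : ℝ :=
  if m < 0 then 0 else (qFactorial q m.toNat)⁻¹

section QFactorial

variable {q : ℝ}

lemma qFactorial_succ (q : ℝ) (n : ℕ) :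
    qFactorial q (n + 1) = qFactorial q n * (1 - q ^ (n + 1)) := by
  rw [qFactorial, Finset.prod_range_succ, qFactorial]

lemma one_sub_pow_succ_pos (h0 : 0 < q) (h1 : q < 1) (n : ℕ) : 0 < 1 - q ^ (n + 1) :=
  sub_pos.2 (pow_lt_one₀ h0.le h1 n.succ_ne_zero)

lemma qFactorial_pos (h0 : 0 < q) (h1 : q < 1) (n : ℕ) : 0 < qFactorial q n :=
  Finset.prod_pos fun i _ => one_sub_pow_succ_pos h0 h1 i

lemma qFactorial_antitone (h0 : 0 < q) (h1 : q < 1) : Antitone (qFactorial q) := by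
  refine antitone_nat_of_succ_le fun n => ?_
  rw [qFactorial_succ]
  have := pow_pos h0 (n + 1)
  exact mul_le_of_le_one_right (qFactorial_pos h0 h1 n).le (by linarith)

lemma qFactorial_le_one (h0 : 0 < q) (h1 : q < 1) (n : ℕ) : qFactorial q n ≤ 1 := by
  simpa [qFactorial] using qFactorial_antitone h0 h1 n.zero_le

lemma summable_norm_neg_pow_succ (h0 : 0 < q) (h1 : q < 1) :
    Summable fun n : ℕ => ‖-q ^ (n + 1)‖ := by
  simpa [abs_of_pos h0] using (summable_nat_add_iff 1).mpr (summable_geometric_of_lt_one h0.le h1)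

lemma tendsto_qFactorial (h0 : 0 < q) (h1 : q < 1) :
    Tendsto (qFactorial q) atTop (𝓝 (eulerProd q)) := by
  have := multipliable_one_add_of_summable (summable_norm_neg_pow_succ h0 h1)
  simp only [← sub_eq_add_neg] at this
  exact this.hasProd.tendsto_prod_nat

lemma eulerProd_le_qFactorial (h0 : 0 < q) (h1 : q < 1) (n : ℕ) :
    eulerProd q ≤ qFactorial q n :=
  (qFactorial_antitone h0 h1).le_of_tendsto (tendsto_qFactorial h0 h1) n

lemma eulerProd_pos (h0 : 0 < q) (h1 : q < 1) : 0 < eulerProd q := by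
  refine lt_of_le_of_ne (ge_of_tendsto' (tendsto_qFactorial h0 h1)
    fun n => (qFactorial_pos h0 h1 n).le) (Ne.symm ?_)
  have := tprod_one_add_ne_zero_of_summable (f := fun n : ℕ => -q ^ (n + 1))
    (fun n => by
      have := one_sub_pow_succ_pos h0 h1 n
      rw [← sub_eq_add_neg]
      exact this.ne') (summable_norm_neg_pow_succ h0 h1)
  simpa [eulerProd, ← sub_eq_add_neg] using this

lemma qFactorialInv_nonneg (h0 : 0 < q) (h1 : q < 1) (m : ℤ) : 0 ≤ qFactorialInv q m := by
  unfold qFactorialInv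
  split_ifs
  · exact le_rfl
  · exact (inv_pos.2 (qFactorial_pos h0 h1 _)).le

lemma qFactorialInv_le (h0 : 0 < q) (h1 : q < 1) (m : ℤ) :
    qFactorialInv q m ≤ (eulerProd q)⁻¹ := by
  unfold qFactorialInv
  split_ifs
  · exact (inv_pos.2 (eulerProd_pos h0 h1)).le
  · exact inv_anti₀ (eulerProd_pos h0 h1) (eulerProd_le_qFactorial h0 h1 _)

lemma qFactorialInv_eq_mul (h0 : 0 < q) (h1 : q < 1) (m : ℤ) :
    qFactorialInv q m = (1 - q ^ (m + 1)) * qFactorialInv q (m + 1) := by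
  rcases lt_trichotomy m (-1) with h | rfl | h
  · rw [qFactorialInv, qFactorialInv, if_pos (by omega), if_pos (by omega), mul_zero]
  · simp [qFactorialInv]
  · obtain ⟨n, rfl⟩ := Int.eq_ofNat_of_zero_le (show 0 ≤ m by omega)
    rw [qFactorialInv, qFactorialInv, if_neg (by omega), if_neg (by omega)]
    have e : ((n : ℤ) + 1).toNat = n + 1 := by omega
    rw [e, Int.toNat_natCast, qFactorial_succ]
    have := one_sub_pow_succ_pos h0 h1 n
    have := qFactorial_pos h0 h1 n
    have e' : q ^ ((n : ℤ) + 1) = q ^ (n + 1) := by exact_mod_cast zpow_natCast q (n + 1)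
    rw [e']
    field_simp

lemma tendsto_qFactorialInv (h0 : 0 < q) (h1 : q < 1) :
    Tendsto (qFactorialInv q) atTop (𝓝 (eulerProd q)⁻¹) := by
  have h : Tendsto (fun m : ℤ => (qFactorial q m.toNat)⁻¹) atTop (𝓝 (eulerProd q)⁻¹) :=
    ((tendsto_qFactorial h0 h1).comp
      (tendsto_atTop.2 fun b => by
        filter_upwards [eventually_ge_atTop (b : ℤ)] with m hm
        omega)).inv₀
      (eulerProd_pos h0 h1).ne'
  refine h.congr' ?_
  filter_upwards [eventually_ge_atTop 0] with m hm
  rw [qFactorialInv, if_neg (by omega)]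

end QFactorial

/-- The coefficient of `z ^ k` in the finite product
`∏ i < N, (1 - z * p ^ (2 * i + 1)) * (1 - z⁻¹ * p ^ (2 * i + 1))`. -/
noncomputable def tripleCoeff (p : ℝ) (N : ℕ) (k : ℤ) : ℝ :=
  (-1) ^ k * p ^ (k ^ 2) * qFactorial (p ^ 2) (2 * N) *
    (qFactorialInv (p ^ 2) (N - k) * qFactorialInv (p ^ 2) (N + k))

section TripleProduct

variable {p : ℝ}

lemma tripleCoeff_zero (p : ℝ) (k : ℤ) : tripleCoeff p 0 k = if k = 0 then 1 else 0 := by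
  split_ifs with h
  · subst h; simp [tripleCoeff, qFactorialInv, qFactorial]
  · rcases lt_or_gt_of_ne h with h | h
    · simp [tripleCoeff, qFactorialInv, h]
    · simp [tripleCoeff, qFactorialInv, h]

lemma tripleCoeff_succ (h0 : 0 < p) (h1 : p < 1) (N : ℕ) (k : ℤ) :
    tripleCoeff p (N + 1) k = (1 + p ^ (4 * N + 2)) * tripleCoeff p N k -
      p ^ (2 * N + 1) * (tripleCoeff p N (k - 1) + tripleCoeff p N (k + 1)) := by
  have q0 : 0 < p ^ 2 := by positivity
  have q1 : p ^ 2 < 1 := pow_lt_one₀ h0.le h1 two_ne_zero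
  have hr := qFactorialInv_eq_mul q0 q1
  have a1 := hr (N - k)
  have a2 := hr (N + k)
  have a3 := hr (N + (k - 1))
  have a4 := hr (N - (k + 1))
  have e3 : (N : ℤ) + (k - 1) + 1 = N + k := by ring
  have e4 : (N : ℤ) - (k + 1) + 1 = N - k := by ring
  rw [e3] at a3
  rw [e4] at a4
  have c1 : ((N + 1 : ℕ) : ℤ) - k = N - k + 1 := by push_cast; ring
  have c2 : ((N + 1 : ℕ) : ℤ) + k = N + k + 1 := by push_cast; ring
  have c3 : (N : ℤ) - (k - 1) = N - k + 1 := by ring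
  have c4 : (N : ℤ) + (k + 1) = N + k + 1 := by ring
  simp only [tripleCoeff, c1, c2, c3, c4]
  rw [a3, a4, a1, a2]
  have hp : p ≠ 0 := h0.ne'
  have s1 : ((-1 : ℝ)) ^ (k - 1) = -(-1) ^ k := by
    rw [zpow_sub_one₀ (by norm_num)]; norm_num
  have s2 : ((-1 : ℝ)) ^ (k + 1) = -(-1) ^ k := by
    rw [zpow_add_one₀ (by norm_num)]; norm_num
  have z1 : p ^ ((k - 1) ^ 2) = p ^ (k ^ 2) * (p ^ k)⁻¹ ^ 2 * p := by
    rw [show (k - 1) ^ 2 = k ^ 2 + (-k) + (-k) + 1 by ring, zpow_add_one₀ hp, zpow_add₀ hp,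
      zpow_add₀ hp, zpow_neg]; ring
  have z2 : p ^ ((k + 1) ^ 2) = p ^ (k ^ 2) * (p ^ k) ^ 2 * p := by
    rw [show (k + 1) ^ 2 = k ^ 2 + k + k + 1 by ring, zpow_add_one₀ hp, zpow_add₀ hp,
      zpow_add₀ hp]; ring
  have q2 : ∀ m : ℤ, (p ^ 2) ^ m = (p ^ m) ^ 2 := fun m => by
    rw [← zpow_natCast, ← zpow_natCast, ← zpow_mul, ← zpow_mul, mul_comm]
  have hk : p ^ k ≠ 0 := zpow_ne_zero _ hp
  have f1 : qFactorial (p ^ 2) (2 * (N + 1)) = qFactorial (p ^ 2) (2 * N) *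
      (1 - p ^ (4 * N + 2)) * (1 - p ^ (4 * N + 4)) := by
    rw [show 2 * (N + 1) = 2 * N + 1 + 1 by ring, qFactorial_succ, qFactorial_succ,
      ← pow_mul, ← pow_mul]
    ring_nf
  rw [s1, s2, z1, z2, f1]
  simp only [q2, zpow_add₀ hp, zpow_sub₀ hp, zpow_natCast, zpow_one]
  generalize qFactorialInv (p ^ 2) (N - k + 1) = r1
  generalize qFactorialInv (p ^ 2) (N + k + 1) = r2
  generalize qFactorial (p ^ 2) (2 * N) = r3
  generalize p ^ k = y at *
  generalize p ^ (k ^ 2) = w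
  generalize ((-1 : ℝ)) ^ k = s
  rw [show p ^ (4 * N + 2) = (p ^ N) ^ 4 * p ^ 2 by ring,
    show p ^ (4 * N + 4) = (p ^ N) ^ 4 * p ^ 4 by ring,
    show p ^ (2 * N + 1) = (p ^ N) ^ 2 * p by ring]
  generalize p ^ N = x
  field_simp
  ring

/-- The finite form of the Jacobi triple product identity. -/
lemma hasSum_tripleCoeff (h0 : 0 < p) (h1 : p < 1) {z : ℝ} (hz : z ≠ 0) (N : ℕ) :
    HasSum (fun k : ℤ => tripleCoeff p N k * z ^ k)
      (∏ i ∈ Finset.range N, (1 - z * p ^ (2 * i + 1)) * (1 - z⁻¹ * p ^ (2 * i + 1))) := by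
  induction N with
  | zero =>
    simp only [tripleCoeff_zero, Finset.range_zero, Finset.prod_empty]
    convert hasSum_ite_eq (0 : ℤ) (1 : ℝ) using 2 with k
    split_ifs with h <;> simp [h]
  | succ N ih =>
    have hm := ((Equiv.subRight (1 : ℤ)).hasSum_iff.2 ih).mul_left z
    have hp := ((Equiv.addRight (1 : ℤ)).hasSum_iff.2 ih).mul_left z⁻¹
    have := (ih.mul_left (1 + p ^ (4 * N + 2))).sub ((hm.add hp).mul_left (p ^ (2 * N + 1)))
    rw [Finset.prod_range_succ]
    convert! this using 1
    · funext k
      rw [tripleCoeff_succ h0 h1]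
      simp only [Function.comp_apply, Equiv.subRight_apply, Equiv.coe_addRight,
        zpow_sub_one₀ hz, zpow_add_one₀ hz]
      field_simp
    · field_simp
      ring

lemma hasSum_mul_tripleCoeff (h0 : 0 < p) (h1 : p < 1) (N : ℕ) :
    HasSum (fun k : ℤ => k * (tripleCoeff p (N + 1) k * p ^ k))
      (qFactorial (p ^ 2) (N + 1) * qFactorial (p ^ 2) N) := by
  have hp0 : p ≠ 0 := h0.ne'
  have key : ∀ (M : ℕ) (D S : ℝ), HasSum (fun k : ℤ => k * (tripleCoeff p M k * p ^ k)) D →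
      HasSum (fun k : ℤ => tripleCoeff p M k * p ^ k) S →
      HasSum (fun k : ℤ => k * (tripleCoeff p (M + 1) k * p ^ k))
        ((1 - p ^ (2 * M)) * (1 - p ^ (2 * M + 2)) * D + (p ^ (2 * M) - p ^ (2 * M + 2)) * S) := by
    intro M D S hD hS
    have hm := ((Equiv.subRight (1 : ℤ)).hasSum_iff.2 (hD.add hS)).mul_left p
    have hp := ((Equiv.addRight (1 : ℤ)).hasSum_iff.2 (hD.sub hS)).mul_left p⁻¹
    have := (hD.mul_left (1 + p ^ (4 * M + 2))).sub ((hm.add hp).mul_left (p ^ (2 * M + 1)))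
    convert! this using 1
    · funext k
      rw [tripleCoeff_succ h0 h1]
      simp only [Function.comp_apply, Equiv.subRight_apply, Equiv.coe_addRight,
        zpow_sub_one₀ hp0, zpow_add_one₀ hp0]
      push_cast
      field_simp
      ring
    · field_simp
      ring
  induction N with
  | zero =>
    have hS := hasSum_tripleCoeff h0 h1 hp0 0
    have hD : HasSum (fun k : ℤ => k * (tripleCoeff p 0 k * p ^ k)) 0 := by
      convert hasSum_zero with k
      rw [tripleCoeff_zero]
      split_ifs with h <;> simp [h]
    convert key 0 _ _ hD hS using 1
    simp [qFactorial]
  | succ N ih =>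
    have hS := hasSum_tripleCoeff h0 h1 hp0 (N + 1)
    rw [Finset.prod_range_succ'] at hS
    convert key _ _ _ ih hS using 1
    rw [qFactorial_succ _ (N + 1)]
    nth_rewrite 2 [qFactorial_succ _ N]
    rw [← pow_mul, ← pow_mul]
    simp [hp0]
    ring

lemma tendsto_tripleCoeff (h0 : 0 < p) (h1 : p < 1) (k : ℤ) :
    Tendsto (fun N => tripleCoeff p N k) atTop
      (𝓝 ((-1) ^ k * p ^ (k ^ 2) * (eulerProd (p ^ 2))⁻¹)) := by
  have q0 : 0 < p ^ 2 := by positivity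
  have q1 : p ^ 2 < 1 := pow_lt_one₀ h0.le h1 two_ne_zero
  have hE := (eulerProd_pos q0 q1).ne'
  have t1 := (tendsto_qFactorial q0 q1).comp (tendsto_id.const_mul_atTop' (r := 2) two_pos)
  have t2 := (tendsto_qFactorialInv q0 q1).comp
    (tendsto_atTop_add_const_right atTop (-k) (tendsto_natCast_atTop_atTop (R := ℤ)))
  have t3 := (tendsto_qFactorialInv q0 q1).comp
    (tendsto_atTop_add_const_right atTop k (tendsto_natCast_atTop_atTop (R := ℤ)))
  have := (t1.const_mul ((-1) ^ k * p ^ (k ^ 2))).mul (t2.mul t3)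
  convert this using 2
  · simp [tripleCoeff, sub_eq_add_neg]
  · field_simp

lemma abs_tripleCoeff_le (h0 : 0 < p) (h1 : p < 1) (N : ℕ) (k : ℤ) :
    |tripleCoeff p N k| ≤ p ^ (k ^ 2) * (eulerProd (p ^ 2))⁻¹ ^ 2 := by
  have q0 : 0 < p ^ 2 := by positivity
  have q1 : p ^ 2 < 1 := pow_lt_one₀ h0.le h1 two_ne_zero
  have n1 := qFactorialInv_nonneg q0 q1
  have n2 := qFactorialInv_le q0 q1
  have hk : 0 < p ^ (k ^ 2) := zpow_pos h0 _
  rw [tripleCoeff, abs_mul, abs_mul, abs_mul, abs_zpow, abs_neg, abs_one, one_zpow, one_mul,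
    abs_of_pos hk, abs_of_pos (qFactorial_pos q0 q1 _), abs_of_nonneg (mul_nonneg (n1 _) (n1 _)),
    sq _⁻¹]
  refine mul_le_mul (mul_le_of_le_one_right hk.le (qFactorial_le_one q0 q1 _))
    (mul_le_mul (n2 _) (n2 _) (n1 _) ((n1 _).trans (n2 0)) )
    (mul_nonneg (n1 _) (n1 _)) hk.le

/-- The Jacobi triple product identity. -/
lemma tendsto_tripleProduct (h0 : 0 < p) (h1 : p < 1) {z : ℝ} (hz : 0 < z)
    (hs : Summable fun k : ℤ => p ^ (k ^ 2) * z ^ k) :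
    Tendsto (fun N => ∏ i ∈ Finset.range N,
      (1 - z * p ^ (2 * i + 1)) * (1 - z⁻¹ * p ^ (2 * i + 1))) atTop
      (𝓝 ((∑' k : ℤ, (-1) ^ k * (p ^ (k ^ 2) * z ^ k)) / eulerProd (p ^ 2))) := by
  have := tendsto_tsum_of_dominated_convergence (𝓕 := atTop)
    (f := fun (N : ℕ) (k : ℤ) => tripleCoeff p N k * z ^ k)
    (hs.mul_right ((eulerProd (p ^ 2))⁻¹ ^ 2))
    (fun k => (tendsto_tripleCoeff h0 h1 k).mul_const (z ^ k))
    (Eventually.of_forall fun N k => by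
      rw [norm_mul, Real.norm_eq_abs, Real.norm_eq_abs, abs_of_pos (zpow_pos hz k)]
      have := mul_le_mul_of_nonneg_right (abs_tripleCoeff_le h0 h1 N k) (zpow_pos hz k).le
      linarith)
  simp only [(hasSum_tripleCoeff h0 h1 hz.ne' _).tsum_eq] at this
  convert this using 2
  rw [div_eq_mul_inv, ← tsum_mul_right]
  congr 1; funext k; ring

/-- Jacobi's identity for the cube of Euler's product. -/
lemma tsum_int_mul_eq_eulerProd_cube (h0 : 0 < p) (h1 : p < 1)
    (hs : Summable fun k : ℤ => |(k : ℝ)| * (p ^ (k ^ 2) * p ^ k)) :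
    ∑' k : ℤ, (k : ℝ) * ((-1) ^ k * (p ^ (k ^ 2) * p ^ k)) = eulerProd (p ^ 2) ^ 3 := by
  have q0 : 0 < p ^ 2 := by positivity
  have q1 : p ^ 2 < 1 := pow_lt_one₀ h0.le h1 two_ne_zero
  have hE := (eulerProd_pos q0 q1).ne'
  have := tendsto_tsum_of_dominated_convergence (𝓕 := atTop)
    (f := fun (N : ℕ) (k : ℤ) => (k : ℝ) * (tripleCoeff p (N + 1) k * p ^ k))
    (hs.mul_right ((eulerProd (p ^ 2))⁻¹ ^ 2))
    (fun k => (((tendsto_add_atTop_iff_nat 1).2 (tendsto_tripleCoeff h0 h1 k)).mul_const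
      (p ^ k)).const_mul (k : ℝ))
    (Eventually.of_forall fun N k => by
      rw [norm_mul, norm_mul, Real.norm_eq_abs, Real.norm_eq_abs, Real.norm_eq_abs,
        abs_of_pos (zpow_pos h0 k)]
      have := mul_le_mul_of_nonneg_left (mul_le_mul_of_nonneg_right
        (abs_tripleCoeff_le h0 h1 (N + 1) k) (zpow_pos h0 k).le) (abs_nonneg (k : ℝ))
      linarith)
  simp only [(hasSum_mul_tripleCoeff h0 h1 _).tsum_eq] at this
  have h2 := ((tendsto_add_atTop_iff_nat 1).2 (tendsto_qFactorial q0 q1)).mul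
    (tendsto_qFactorial q0 q1)
  have h3 := tendsto_nhds_unique h2 this
  have h4 : (∑' k : ℤ, (k : ℝ) * ((-1) ^ k * (p ^ (k ^ 2) * p ^ k))) * (eulerProd (p ^ 2))⁻¹ =
      eulerProd (p ^ 2) * eulerProd (p ^ 2) := by
    rw [h3, ← tsum_mul_right]
    congr 1; funext k; ring
  rw [mul_inv_eq_iff_eq_mul₀ hE] at h4
  rw [h4]
  ring

end TripleProduct

section Theta

variable {x : ℝ}

lemma summable_abs_pow_mul_zpow (h0 : 0 < x) (h1 : x < 1) {A : ℤ} (hA : 0 < A) (B : ℤ) (j : ℕ) :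
    Summable fun k : ℤ => |(k : ℝ)| ^ j * x ^ (A * k ^ 2 + B * k) := by
  have hl : log x < 0 := log_neg h0 h1
  have hA' : (0 : ℝ) < A := by exact_mod_cast hA
  have hT : 0 < A * (-log x) / π := div_pos (mul_pos hA' (by linarith)) pi_pos
  refine (summable_pow_mul_jacobiTheta₂_term_bound (|(B : ℝ)| * (-log x) / (2 * π)) hT
    j).of_nonneg_of_le (fun k => by positivity) fun k => ?_
  push_cast
  refine mul_le_mul_of_nonneg_left ?_ (by positivity)
  rw [← rpow_intCast, rpow_def_of_pos h0, exp_le_exp]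
  have e : -π * (A * -log x / π * (k : ℝ) ^ 2 - 2 * (|(B : ℝ)| * -log x / (2 * π)) * |(k : ℝ)|)
      = log x * (A * k ^ 2) + (-log x) * (|(B : ℝ)| * |(k : ℝ)|) := by
    field_simp
    ring
  rw [e, ← abs_mul]
  push_cast
  nlinarith [neg_abs_le ((B : ℝ) * k)]

lemma summable_zpow_quadratic (h0 : 0 < x) (h1 : x < 1) {A : ℤ} (hA : 0 < A) (B : ℤ) :
    Summable fun k : ℤ => x ^ (A * k ^ 2 + B * k) := by
  simpa using summable_abs_pow_mul_zpow h0 h1 hA B 0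

lemma summable_norm_sign_zpow_quadratic (h0 : 0 < x) (h1 : x < 1) {A : ℤ} (hA : 0 < A) (B : ℤ) :
    Summable fun k : ℤ => ‖(-1 : ℝ) ^ k * x ^ (A * k ^ 2 + B * k)‖ := by
  simpa [abs_of_pos h0] using summable_zpow_quadratic h0 h1 hA B

lemma summable_norm_mul_sign_zpow_quadratic (h0 : 0 < x) (h1 : x < 1) {A : ℤ} (hA : 0 < A)
    (B : ℤ) : Summable fun k : ℤ => ‖(k : ℝ) * ((-1 : ℝ) ^ k * x ^ (A * k ^ 2 + B * k))‖ := by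
  simpa [abs_of_pos h0] using summable_abs_pow_mul_zpow h0 h1 hA B 1

/-- The Jacobi triple product identity with both parameters powers of `x`. -/
lemma tendsto_tripleProduct_zpow (h0 : 0 < x) (h1 : x < 1) {a : ℕ} (ha : a ≠ 0) (b : ℤ) :
    Tendsto (fun N => ∏ i ∈ Finset.range N,
      (1 - x ^ b * x ^ (a * (2 * i + 1))) * (1 - (x ^ b)⁻¹ * x ^ (a * (2 * i + 1)))) atTop
      (𝓝 ((∑' k : ℤ, (-1) ^ k * x ^ (a * k ^ 2 + b * k)) / eulerProd (x ^ (2 * a)))) := by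
  have e : ∀ k : ℤ, (x ^ a) ^ (k ^ 2) * (x ^ b) ^ k = x ^ (a * k ^ 2 + b * k) := fun k => by
    rw [zpow_add₀ h0.ne', zpow_mul, zpow_mul, zpow_natCast]
  have := tendsto_tripleProduct (pow_pos h0 a) (pow_lt_one₀ h0.le h1 ha) (zpow_pos h0 b)
    (by
      simp only [e]
      exact summable_zpow_quadratic h0 h1 (by omega) b)
  simp only [e] at this
  simpa only [← pow_mul, mul_comm a 2] using this

/-- Euler's pentagonal number theorem. -/
lemma tsum_pentagonal (h0 : 0 < x) (h1 : x < 1) :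
    ∑' k : ℤ, (-1 : ℝ) ^ k * x ^ (3 * k ^ 2 + k) = eulerProd (x ^ 2) := by
  have t1 := tendsto_tripleProduct_zpow h0 h1 three_ne_zero 1
  have q6 := tendsto_qFactorial (pow_pos h0 6) (pow_lt_one₀ h0.le h1 (by norm_num))
  have q2 := (tendsto_qFactorial (pow_pos h0 2) (pow_lt_one₀ h0.le h1 (by norm_num))).comp
    (tendsto_id.const_mul_atTop' (r := 3) three_pos)
  have hE := (eulerProd_pos (pow_pos h0 6) (pow_lt_one₀ h0.le h1 (by norm_num))).ne'
  have e : ∀ N : ℕ, (∏ i ∈ Finset.range N,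
      (1 - x ^ (1 : ℤ) * x ^ (3 * (2 * i + 1))) * (1 - (x ^ (1 : ℤ))⁻¹ * x ^ (3 * (2 * i + 1)))) *
      qFactorial (x ^ 6) N = qFactorial (x ^ 2) (3 * N) := by
    intro N
    induction N with
    | zero => simp [qFactorial]
    | succ N ih =>
      rw [Finset.prod_range_succ, qFactorial_succ, show 3 * (N + 1) = 3 * N + 1 + 1 + 1 by ring,
        qFactorial_succ, qFactorial_succ, qFactorial_succ, ← ih, zpow_one,
        show x⁻¹ * x ^ (3 * (2 * N + 1)) = x ^ (6 * N + 2) by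
          rw [show 3 * (2 * N + 1) = 6 * N + 2 + 1 by ring, pow_succ]; field_simp]
      ring
  have h := tendsto_nhds_unique ((t1.mul q6).congr e) q2
  simp only [Nat.cast_ofNat, one_mul, Nat.reduceMul] at h
  rw [← h]
  field_simp

lemma tendsto_prod_one_sub_odd_pow (h0 : 0 < x) (h1 : x < 1) :
    Tendsto (fun N => ∏ i ∈ Finset.range N, (1 - x ^ (4 * i + 2))) atTop
      (𝓝 (eulerProd (x ^ 2) / eulerProd (x ^ 4))) := by
  have q4 := tendsto_qFactorial (pow_pos h0 4) (pow_lt_one₀ h0.le h1 (by norm_num))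
  have q2 := (tendsto_qFactorial (pow_pos h0 2) (pow_lt_one₀ h0.le h1 (by norm_num))).comp
    (tendsto_id.const_mul_atTop' (r := 2) two_pos)
  have hE := (eulerProd_pos (pow_pos h0 4) (pow_lt_one₀ h0.le h1 (by norm_num))).ne'
  refine (q2.div q4 hE).congr fun N => ?_
  have hq := (qFactorial_pos (pow_pos h0 4) (pow_lt_one₀ h0.le h1 (by norm_num)) N).ne'
  simp only [Function.comp_apply, id, Pi.div_apply]
  rw [div_eq_iff hq]
  clear hq
  induction N with
  | zero => simp [qFactorial]
  | succ N ih =>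
    rw [Finset.prod_range_succ, qFactorial_succ, show 2 * (N + 1) = 2 * N + 1 + 1 by ring,
      qFactorial_succ, qFactorial_succ, ih]
    ring

/-- Gauss's product for the theta series of alternating squares. -/
lemma tsum_sign_sq_mul_eulerProd (h0 : 0 < x) (h1 : x < 1) :
    (∑' k : ℤ, (-1 : ℝ) ^ k * x ^ (2 * k ^ 2)) * eulerProd (x ^ 4) = eulerProd (x ^ 2) ^ 2 := by
  have t1 := tendsto_tripleProduct_zpow h0 h1 two_ne_zero 0
  have t2 := tendsto_prod_one_sub_odd_pow h0 h1
  have hE := (eulerProd_pos (pow_pos h0 4) (pow_lt_one₀ h0.le h1 (by norm_num))).ne'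
  have h := tendsto_nhds_unique ((t2.mul t2).congr fun N => ?_) t1
  · simp only [Nat.cast_ofNat, zero_mul, add_zero, Nat.reduceMul] at h
    field_simp at h
    rw [h, mul_comm]
  · rw [← Finset.prod_mul_distrib]
    refine Finset.prod_congr rfl fun i _ => ?_
    rw [zpow_zero, inv_one, one_mul, show 2 * (2 * i + 1) = 4 * i + 2 by ring]

/-- Gauss's product for the theta series of triangular numbers, with alternating signs. -/
lemma tsum_sign_triangular_mul_eulerProd (h0 : 0 < x) (h1 : x < 1) :
    (∑' k : ℤ, (-1 : ℝ) ^ k * x ^ (4 * k ^ 2 + 2 * k)) * eulerProd (x ^ 4) =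
      eulerProd (x ^ 2) * eulerProd (x ^ 8) := by
  have t1 := tendsto_tripleProduct_zpow h0 h1 four_ne_zero 2
  have t2 := (tendsto_prod_one_sub_odd_pow h0 h1).comp
    (tendsto_id.const_mul_atTop' (r := 2) two_pos)
  have hE := (eulerProd_pos (pow_pos h0 4) (pow_lt_one₀ h0.le h1 (by norm_num))).ne'
  have hE' := (eulerProd_pos (pow_pos h0 8) (pow_lt_one₀ h0.le h1 (by norm_num))).ne'
  have h := tendsto_nhds_unique (t2.congr fun N => ?_) t1
  · simp only [Nat.cast_ofNat, Nat.reduceMul] at h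
    field_simp at h
    linarith
  · simp only [Function.comp_apply, id]
    induction N with
    | zero => simp
    | succ N ih =>
      rw [Finset.prod_range_succ, show 2 * (N + 1) = 2 * N + 1 + 1 by ring,
        Finset.prod_range_succ, Finset.prod_range_succ, ih,
        show (x ^ (2 : ℤ))⁻¹ * x ^ (4 * (2 * N + 1)) = x ^ (8 * N + 2) by
          rw [show 4 * (2 * N + 1) = 8 * N + 2 + 2 by ring, pow_add x _ 2]
          norm_cast
          field_simp]
      norm_cast
      ring

lemma tsum_int_mul_sign (h0 : 0 < x) (h1 : x < 1) :
    ∑' k : ℤ, (k : ℝ) * ((-1 : ℝ) ^ k * x ^ (k ^ 2 + k)) = eulerProd (x ^ 2) ^ 3 := by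
  rw [← tsum_int_mul_eq_eulerProd_cube h0 h1]
  · simp only [zpow_add₀ h0.ne']
  · simpa [zpow_add₀ h0.ne'] using summable_abs_pow_mul_zpow h0 h1 one_pos 1 1

end Theta

lemma hasSum_prod_mul_of_summable_norm {ι κ : Type*} {f : ι → ℝ} {g : κ → ℝ}
    (hf : Summable fun i => ‖f i‖) (hg : Summable fun i => ‖g i‖) :
    HasSum (fun p : ι × κ => f p.1 * g p.2) ((∑' i, f i) * ∑' j, g j) := by
  rw [tsum_mul_tsum_of_summable_norm hf hg]
  exact (summable_mul_of_summable_norm hf hg).hasSum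

lemma tsum_eq_zero_of_antisymmetric {ι : Type*} {f : ι → ℝ} (e : ι ≃ ι)
    (h : ∀ i, f (e i) = -f i) : ∑' i, f i = 0 := by
  have h1 := e.tsum_eq f
  simp only [h, tsum_neg] at h1
  linarith

/-- The change of variables `m = j + r - 2 * n - 1`, `k = n + j` that separates the residue
classes modulo `3` of `m + 2 * k + 1`. -/
def residueEquiv : Fin 3 × ℤ × ℤ ≃ ℤ × ℤ where
  toFun p := (p.2.1 + (p.1 : ℕ) - 2 * p.2.2 - 1, p.2.2 + p.2.1)
  invFun s := (⟨((s.1 + 2 * s.2 + 1) % 3).toNat, by omega⟩, (s.1 + 2 * s.2 + 1) / 3,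
    s.2 - (s.1 + 2 * s.2 + 1) / 3)
  left_inv := by
    rintro ⟨⟨r, hr⟩, j, n⟩
    have h : j + (r : ℤ) - 2 * n - 1 + 2 * (n + j) + 1 = r + 3 * j := by ring
    simp only [h, Prod.mk.injEq, Fin.mk.injEq]
    omega
  right_inv := by
    rintro ⟨m, n⟩
    simp only [Prod.mk.injEq]
    omega

section Theta

variable {x : ℝ}

lemma neg_one_zpow_neg_sub (n : ℤ) : (-1 : ℝ) ^ (-1 - n) = -(-1) ^ n := by
  rw [sub_eq_add_neg, zpow_add₀ (by norm_num), zpow_neg _ n, ← inv_zpow]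
  norm_num

lemma neg_one_zpow_two_mul_sub (j n : ℤ) : (-1 : ℝ) ^ (2 * j - n) = (-1) ^ n := by
  rw [sub_eq_add_neg, zpow_add₀ (by norm_num), zpow_mul, zpow_neg, ← inv_zpow (-1 : ℝ) n]
  norm_num

lemma zpow_quadratic_reflect (x : ℝ) (A n : ℤ) :
    x ^ (A * (-1 - n) ^ 2 + A * (-1 - n)) = x ^ (A * n ^ 2 + A * n) := by
  congr 1; ring

lemma tsum_sign_zpow_quadratic_self (x : ℝ) (A : ℤ) :
    ∑' n : ℤ, (-1 : ℝ) ^ n * x ^ (A * n ^ 2 + A * n) = 0 :=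
  tsum_eq_zero_of_antisymmetric (Equiv.subLeft (-1)) fun n => by
    rw [Equiv.subLeft_apply, neg_one_zpow_neg_sub, zpow_quadratic_reflect, neg_mul]

lemma summable_norm_affine_mul_zpow (h0 : 0 < x) (h1 : x < 1) {A : ℤ} (hA : 0 < A) (B : ℤ)
    (a b : ℝ) : Summable fun j : ℤ => ‖(a * j + b) * x ^ (A * j ^ 2 + B * j)‖ := by
  have s0 := (summable_zpow_quadratic h0 h1 hA B).mul_left |b|
  have s1 := (summable_abs_pow_mul_zpow h0 h1 hA B 1).mul_left |a|
  refine (s1.add s0).of_nonneg_of_le (fun _ => norm_nonneg _) fun j => ?_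
  have hx := zpow_pos h0 (A * j ^ 2 + B * j)
  rw [norm_mul, Real.norm_eq_abs, Real.norm_eq_abs, abs_of_pos hx, pow_one, ← mul_assoc, ← add_mul,
    ← abs_mul]
  exact mul_le_mul_of_nonneg_right (abs_add_le _ _) hx.le

/-- A derivative form of the quintuple product identity. -/
lemma tsum_affine_zpow_mul_eulerProd (h0 : 0 < x) (h1 : x < 1) :
    (∑' j : ℤ, (3 * (j : ℝ) + 1) * x ^ (6 * j ^ 2 + 4 * j)) =
      (∑' k : ℤ, (-1 : ℝ) ^ k * x ^ (2 * k ^ 2)) * eulerProd (x ^ 8) ^ 2 := by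
  have hx : x ≠ 0 := h0.ne'
  have hE := eulerProd_pos (pow_pos h0 8) (pow_lt_one₀ h0.le h1 (by norm_num))
  have x4 : 0 < x ^ 4 := pow_pos h0 4
  have x41 : x ^ 4 < 1 := pow_lt_one₀ h0.le h1 (by norm_num)
  have e4 : ∀ m : ℤ, (x ^ 4) ^ m = x ^ (4 * m) := fun m => by
    rw [zpow_mul]; norm_cast
  have cube : ∑' n : ℤ, (n : ℝ) * ((-1 : ℝ) ^ n * x ^ (4 * n ^ 2 + 4 * n)) =
      eulerProd (x ^ 8) ^ 3 := by
    rw [show x ^ 8 = (x ^ 4) ^ 2 by ring, ← tsum_int_mul_sign x4 x41]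
    simp only [e4, mul_add]
  have euler : ∑' n : ℤ, (-1 : ℝ) ^ n * x ^ (12 * n ^ 2 + 4 * n) = eulerProd (x ^ 8) := by
    rw [show x ^ 8 = (x ^ 4) ^ 2 by ring, ← tsum_pentagonal x4 x41]
    simp only [e4, mul_add, ← mul_assoc]
    norm_num
  have sQ : Summable fun m : ℤ => ‖(-1 : ℝ) ^ m * x ^ (2 * m ^ 2)‖ := by
    simpa using summable_norm_sign_zpow_quadratic h0 h1 two_pos 0
  have sQ' : Summable fun m : ℤ => ‖(m : ℝ) * ((-1 : ℝ) ^ m * x ^ (2 * m ^ 2))‖ := by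
    simpa using summable_norm_mul_sign_zpow_quadratic h0 h1 two_pos 0
  have sR := summable_norm_sign_zpow_quadratic h0 h1 four_pos 4
  have sR' := summable_norm_mul_sign_zpow_quadratic h0 h1 four_pos 4
  have H := ((hasSum_prod_mul_of_summable_norm sQ sR').mul_left 2).add
    ((hasSum_prod_mul_of_summable_norm sQ sR).add (hasSum_prod_mul_of_summable_norm sQ' sR))
  rw [cube, tsum_sign_zpow_quadratic_self, mul_zero, mul_zero, add_zero, add_zero] at H
  have H₁ : HasSum (fun b : ℤ × ℤ => ((b.1 : ℝ) + 2 * b.2 + 1) *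
      ((-1) ^ (b.1 + b.2) * x ^ (2 * b.1 ^ 2 + (4 * b.2 ^ 2 + 4 * b.2))))
      (2 * ((∑' k : ℤ, (-1 : ℝ) ^ k * x ^ (2 * k ^ 2)) * eulerProd (x ^ 8) ^ 3)) := by
    convert! H using 1
    funext b
    rw [zpow_add₀ (by norm_num), zpow_add₀ hx (2 * b.1 ^ 2)]
    ring
  have H' := residueEquiv.hasSum_iff.2 H₁
  have s6 : ∀ B : ℤ, Summable fun n : ℤ => ‖(-1 : ℝ) ^ n * x ^ (12 * n ^ 2 + B * n)‖ :=
    summable_norm_sign_zpow_quadratic h0 h1 (by norm_num)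
  have F0 := (hasSum_prod_mul_of_summable_norm
    (summable_norm_affine_mul_zpow h0 h1 (A := 6) (by norm_num) 0 3 0) (s6 12)).mul_left (-x ^ 2)
  have F1 := hasSum_prod_mul_of_summable_norm
    (summable_norm_affine_mul_zpow h0 h1 (A := 6) (by norm_num) 4 3 1) (s6 4)
  have F2 := (hasSum_prod_mul_of_summable_norm
    (summable_norm_affine_mul_zpow h0 h1 (A := 6) (by norm_num) 8 3 2) (s6 (-4))).mul_left (-x ^ 2)
  have r2 : (∑' j : ℤ, (3 * (j : ℝ) + 2) * x ^ (6 * j ^ 2 + 8 * j)) * x ^ 2 =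
      -∑' j : ℤ, (3 * (j : ℝ) + 1) * x ^ (6 * j ^ 2 + 4 * j) := by
    rw [← tsum_mul_right, ← tsum_neg, ← (Equiv.subLeft (-1 : ℤ)).tsum_eq]
    refine tsum_congr fun j => ?_
    rw [Equiv.subLeft_apply, mul_assoc, ← zpow_natCast x 2, ← zpow_add₀ hx, ← neg_mul]
    congr 1
    · push_cast; ring
    · congr 1; push_cast; ring
  have euler' : ∑' n : ℤ, (-1 : ℝ) ^ n * x ^ (12 * n ^ 2 + -4 * n) = eulerProd (x ^ 8) := by
    rw [← euler, ← (Equiv.neg ℤ).tsum_eq]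
    refine tsum_congr fun n => ?_
    rw [Equiv.neg_apply, zpow_neg, ← inv_zpow]
    norm_num
  rw [tsum_sign_zpow_quadratic_self] at F0
  rw [euler] at F1
  rw [euler'] at F2
  have G := H'.prod_fiberwise (g := ![_, _, _]) (fun r => by
    fin_cases r
    · convert! F0 using 1
      funext p
      simp only [Function.comp_apply, residueEquiv, Equiv.coe_fn_mk]
      rw [show p.1 + ((0 : ℕ) : ℤ) - 2 * p.2 - 1 + (p.2 + p.1) = 2 * p.1 - (p.2 + 1) by
          push_cast; ring,
        neg_one_zpow_two_mul_sub, zpow_add_one₀ (by norm_num),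
        show 2 * (p.1 + ((0 : ℕ) : ℤ) - 2 * p.2 - 1) ^ 2 +
          (4 * (p.2 + p.1) ^ 2 + 4 * (p.2 + p.1)) = 2 + (6 * p.1 ^ 2 + 0 * p.1 + (12 * p.2 ^ 2 + 12 * p.2)) by push_cast; ring]
      rw [zpow_add₀ hx, zpow_add₀ hx _ (12 * p.2 ^ 2 + 12 * p.2), zpow_ofNat]
      push_cast
      ring
    · convert! F1 using 1
      funext p
      simp only [Function.comp_apply, residueEquiv, Equiv.coe_fn_mk]
      rw [show p.1 + ((1 : ℕ) : ℤ) - 2 * p.2 - 1 + (p.2 + p.1) = 2 * p.1 - p.2 by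
          push_cast; ring,
        neg_one_zpow_two_mul_sub,
        show 2 * (p.1 + ((1 : ℕ) : ℤ) - 2 * p.2 - 1) ^ 2 +
          (4 * (p.2 + p.1) ^ 2 + 4 * (p.2 + p.1)) = 6 * p.1 ^ 2 + 4 * p.1 + (12 * p.2 ^ 2 + 4 * p.2) by push_cast; ring]
      rw [zpow_add₀ hx]
      push_cast
      ring
    · convert! F2 using 1
      funext p
      simp only [Function.comp_apply, residueEquiv, Equiv.coe_fn_mk]
      rw [show p.1 + ((2 : ℕ) : ℤ) - 2 * p.2 - 1 + (p.2 + p.1) = 2 * p.1 - (p.2 - 1) by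
          push_cast; ring,
        neg_one_zpow_two_mul_sub, zpow_sub_one₀ (by norm_num),
        show 2 * (p.1 + ((2 : ℕ) : ℤ) - 2 * p.2 - 1) ^ 2 +
          (4 * (p.2 + p.1) ^ 2 + 4 * (p.2 + p.1)) = 2 + (6 * p.1 ^ 2 + 8 * p.1 + (12 * p.2 ^ 2 + -4 * p.2)) by push_cast; ring]
      rw [zpow_add₀ hx, zpow_add₀ hx _ (12 * p.2 ^ 2 + -4 * p.2), zpow_ofNat]
      push_cast
      ring)
  have G' := G.unique (hasSum_fintype _)
  simp only [Fin.sum_univ_three] at G'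
  simp at G'
  have : eulerProd (x ^ 8) * (∑' j : ℤ, (3 * (j : ℝ) + 1) * x ^ (6 * j ^ 2 + 4 * j)) =
     eulerProd (x ^ 8) *
      ((∑' k : ℤ, (-1 : ℝ) ^ k * x ^ (2 * k ^ 2)) * eulerProd (x ^ 8) ^ 2) := by
    linear_combination (-1 / 2) * G' + eulerProd (x ^ 8) / 2 * r2
  exact mul_left_cancel₀ hE.ne' this

end Theta

section Theta

variable {x : ℝ}

lemma neg_one_zpow_neg_natCast_add_one (k : ℕ) : (-1 : ℝ) ^ (-((k : ℤ) + 1)) = -(-1) ^ k := by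
  rw [zpow_neg, ← inv_zpow, inv_neg_one]
  exact_mod_cast (pow_succ (-1 : ℝ) k).trans (mul_neg_one _)

lemma summable_norm_nat_odd_sign (h0 : 0 < x) (h1 : x < 1) :
    Summable fun k : ℕ => ‖(-1 : ℝ) ^ k * (2 * k + 1) * x ^ (k ^ 2 + k)‖ := by
  refine ((summable_norm_affine_mul_zpow h0 h1 one_pos 1 2 1).comp_injective
    Nat.cast_injective).congr fun k => ?_
  simp only [Function.comp_apply, norm_mul, norm_pow, norm_neg, norm_one, one_pow, one_mul,
    Int.cast_natCast]
  norm_cast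
  rw [norm_pow]

/-- Jacobi's identity for the cube of Euler's product, summed over the natural numbers. -/
lemma tsum_nat_odd_sign (h0 : 0 < x) (h1 : x < 1) :
    ∑' k : ℕ, (-1 : ℝ) ^ k * (2 * k + 1) * x ^ (k ^ 2 + k) = eulerProd (x ^ 2) ^ 3 := by
  have hs : Summable fun k : ℤ => (k : ℝ) * ((-1 : ℝ) ^ k * x ^ (k ^ 2 + k)) := by
    simpa using (summable_norm_mul_sign_zpow_quadratic h0 h1 one_pos 1).of_norm
  rw [← tsum_int_mul_sign h0 h1, ← hs.hasSum.nat_add_neg_add_one.tsum_eq]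
  refine tsum_congr fun k => ?_
  rw [neg_one_zpow_neg_natCast_add_one,
    show (-((k : ℤ) + 1)) ^ 2 + -((k : ℤ) + 1) = ((k ^ 2 + k : ℕ) : ℤ) by push_cast; ring,
    show (k : ℤ) ^ 2 + k = ((k ^ 2 + k : ℕ) : ℤ) by push_cast; ring]
  simp only [zpow_natCast]
  push_cast
  ring

/-- The sign of the `n`-th triangular number. -/
lemma neg_one_pow_triangular_two_mul (m : ℕ) :
    (-1 : ℝ) ^ (2 * m * (2 * m + 1) / 2) = (-1) ^ m := by
  rw [mul_assoc, Nat.mul_div_cancel_left _ two_pos, mul_add, mul_one, pow_add,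
    show m * (2 * m) = 2 * (m * m) by ring, pow_mul]
  norm_num

lemma neg_one_pow_triangular_two_mul_add_one (m : ℕ) :
    (-1 : ℝ) ^ ((2 * m + 1) * (2 * m + 1 + 1) / 2) = -(-1) ^ m := by
  rw [show (2 * m + 1) * (2 * m + 1 + 1) = 2 * (2 * (m * (m + 1)) + (m + 1)) by ring,
    Nat.mul_div_cancel_left _ two_pos, pow_add, pow_mul, neg_one_sq, one_pow, one_mul, pow_succ, mul_neg_one]

lemma summable_norm_sign_triangular (h0 : 0 < x) (h1 : x < 1) :
    Summable fun n : ℕ => ‖(-1 : ℝ) ^ (n * (n + 1) / 2) * x ^ (n ^ 2 + n)‖ := by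
  refine ((summable_zpow_quadratic h0 h1 one_pos 1).comp_injective
    Nat.cast_injective).congr fun k => ?_
  simp only [Function.comp_apply, norm_mul, norm_pow, norm_neg, norm_one, one_pow, one_mul,
    Real.norm_eq_abs, abs_of_pos h0]
  norm_cast

lemma tsum_sign_triangular_eq (h0 : 0 < x) (h1 : x < 1) :
    ∑' n : ℕ, (-1 : ℝ) ^ (n * (n + 1) / 2) * x ^ (n ^ 2 + n) =
      ∑' k : ℤ, (-1 : ℝ) ^ k * x ^ (4 * k ^ 2 + 2 * k) := by
  have hs := (summable_norm_sign_zpow_quadratic h0 h1 four_pos 2).of_norm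
  have s1 := (hs.comp_injective Nat.cast_injective).hasSum
  have s2 := (hs.comp_injective (i := fun n : ℕ => -((n : ℤ) + 1))
    fun a b h => by simpa using h).hasSum
  have h := HasSum.of_nat_of_neg_add_one (f := fun k : ℤ => (-1 : ℝ) ^ k * x ^ (4 * k ^ 2 + 2 * k))
    s1 s2
  rw [h.tsum_eq]
  refine (HasSum.even_add_odd ?_ ?_).tsum_eq
  · convert! s1 using 1
    funext m
    rw [neg_one_pow_triangular_two_mul, Function.comp_apply, zpow_natCast,
      show 4 * (m : ℤ) ^ 2 + 2 * m = (((2 * m) ^ 2 + 2 * m : ℕ) : ℤ) by push_cast; ring,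
      zpow_natCast]
  · convert! s2 using 1
    funext m
    rw [neg_one_pow_triangular_two_mul_add_one, Function.comp_apply,
      neg_one_zpow_neg_natCast_add_one,
      show 4 * (-((m : ℤ) + 1)) ^ 2 + 2 * -((m : ℤ) + 1) =
        (((2 * m + 1) ^ 2 + (2 * m + 1) : ℕ) : ℤ) by push_cast; ring, zpow_natCast]

lemma hasSum_eulerProd_one_one_two_two (h0 : 0 < x) (h1 : x < 1) :
    HasSum (fun p : ℤ × ℕ => (-1 : ℝ) ^ p.1 * x ^ (2 * p.1 ^ 2) *
      ((-1 : ℝ) ^ p.2 * (2 * p.2 + 1) * (x ^ 2) ^ (p.2 ^ 2 + p.2)))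
      (eulerProd (x ^ 2) * eulerProd (x ^ 2) * eulerProd (x ^ 4) * eulerProd (x ^ 4)) := by
  have y0 := pow_pos h0 2
  have y1 : x ^ 2 < 1 := pow_lt_one₀ h0.le h1 two_ne_zero
  have sQ : Summable fun m : ℤ => ‖(-1 : ℝ) ^ m * x ^ (2 * m ^ 2)‖ := by
    simpa using summable_norm_sign_zpow_quadratic h0 h1 two_pos 0
  convert! hasSum_prod_mul_of_summable_norm sQ (summable_norm_nat_odd_sign y0 y1) using 1
  rw [tsum_nat_odd_sign y0 y1, ← pow_mul]
  linear_combination (-eulerProd (x ^ 4) ^ 2) * tsum_sign_sq_mul_eulerProd h0 h1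

lemma hasSum_eulerProd_one_one_four_four (h0 : 0 < x) (h1 : x < 1) :
    HasSum (fun p : ℤ × ℤ => (-1 : ℝ) ^ p.1 * (x ^ 2) ^ (3 * p.1 ^ 2 + p.1) *
      ((3 * p.2 + 1) * x ^ (6 * p.2 ^ 2 + 4 * p.2)))
      (eulerProd (x ^ 2) * eulerProd (x ^ 2) * eulerProd (x ^ 8) * eulerProd (x ^ 8)) := by
  have y0 := pow_pos h0 2
  have y1 : x ^ 2 < 1 := pow_lt_one₀ h0.le h1 two_ne_zero
  have s1 : Summable fun n : ℤ => ‖(-1 : ℝ) ^ n * (x ^ 2) ^ (3 * n ^ 2 + n)‖ := by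
    simpa using summable_norm_sign_zpow_quadratic y0 y1 three_pos 1
  convert! hasSum_prod_mul_of_summable_norm s1
    (summable_norm_affine_mul_zpow h0 h1 (A := 6) (by norm_num) 4 3 1) using 1
  rw [tsum_affine_zpow_mul_eulerProd h0 h1, tsum_pentagonal y0 y1, ← pow_mul]
  linear_combination (-eulerProd (x ^ 8) ^ 2) * tsum_sign_sq_mul_eulerProd h0 h1

lemma hasSum_eulerProd_one_two_two_four (h0 : 0 < x) (h1 : x < 1) :
    HasSum (fun p : ℕ × ℕ => (-1 : ℝ) ^ (p.1 * (p.1 + 1) / 2) * x ^ (p.1 ^ 2 + p.1) *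
      ((-1 : ℝ) ^ p.2 * (2 * p.2 + 1) * (x ^ 2) ^ (p.2 ^ 2 + p.2)))
      (eulerProd (x ^ 2) * eulerProd (x ^ 4) * eulerProd (x ^ 4) * eulerProd (x ^ 8)) := by
  have y0 := pow_pos h0 2
  have y1 : x ^ 2 < 1 := pow_lt_one₀ h0.le h1 two_ne_zero
  convert! hasSum_prod_mul_of_summable_norm (summable_norm_sign_triangular h0 h1)
    (summable_norm_nat_odd_sign y0 y1) using 1
  rw [tsum_nat_odd_sign y0 y1, tsum_sign_triangular_eq h0 h1, ← pow_mul]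
  linear_combination (-eulerProd (x ^ 4) ^ 2) * tsum_sign_triangular_mul_eulerProd h0 h1

end Theta

section Eta

/-- The symmetric partial sums of the theta series of the Dedekind eta function. -/
noncomputable def etaPartialSum (v : ℕ) (s : ℝ) : ℝ :=
  ∑ n ∈ Finset.Icc (-(v : ℤ)) v, (-1 : ℝ) ^ n * exp (-(s * ((6 * n + 1 : ℤ) : ℝ) ^ 2))

/-- The Dedekind eta function on the imaginary axis. -/
noncomputable def etaExp (s : ℝ) : ℝ := exp (-s) * eulerProd (exp (-(24 * s)))

lemma exp_neg_twelve_mul_zpow (s : ℝ) (m : ℤ) :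
    exp (-(12 * s)) ^ m = exp (-(12 * s * m)) := by
  rw [← rpow_intCast, ← exp_mul]
  ring_nf

lemma hasSum_etaExp {s : ℝ} (hs : 0 < s) :
    HasSum (fun n : ℤ => (-1 : ℝ) ^ n * exp (-(s * ((6 * n + 1 : ℤ) : ℝ) ^ 2))) (etaExp s) := by
  have h0 : 0 < exp (-(12 * s)) := exp_pos _
  have h1 : exp (-(12 * s)) < 1 := exp_lt_one_iff.2 (by linarith)
  have h := (summable_norm_sign_zpow_quadratic h0 h1 three_pos 1).of_norm.hasSum.mul_left
    (exp (-s))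
  simp only [one_mul] at h
  rw [tsum_pentagonal h0 h1, ← exp_nat_mul] at h
  convert! h using 1
  · funext n
    rw [exp_neg_twelve_mul_zpow, mul_left_comm, ← exp_add]
    push_cast
    ring_nf
  · rw [etaExp]
    push_cast
    ring_nf

lemma tendsto_etaPartialSum {s : ℝ} (hs : 0 < s) :
    Tendsto (fun v => etaPartialSum v s) atTop (𝓝 (etaExp s)) :=
  (hasSum_etaExp hs).comp Finset.tendsto_Icc_neg

lemma etaPartialSum_succ (v : ℕ) (s : ℝ) :
    etaPartialSum (v + 1) s = etaPartialSum v s - (-1) ^ v *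
      (exp (-(s * (6 * (v + 1) + 1) ^ 2)) + exp (-(s * (6 * (v + 1) - 1) ^ 2))) := by
  rw [etaPartialSum, etaPartialSum, Nat.cast_succ, Finset.sum_Icc_succ_eq_add_endpoints,
    neg_one_zpow_neg_natCast_add_one]
  have h : (-1 : ℝ) ^ ((v : ℤ) + 1) = -(-1) ^ v := by
    exact_mod_cast (pow_succ (-1 : ℝ) v).trans (mul_neg_one _)
  rw [h]
  push_cast
  ring_nf

lemma neg_one_pow_mul_etaPartialSum_mem {s : ℝ} (hs : 0 ≤ s) (v : ℕ) :
    (-1) ^ v * etaPartialSum v s ∈ Set.Icc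
      (exp (-(s * (6 * v + 1) ^ 2)) + exp (-(s * (6 * v - 1) ^ 2)) - exp (-s)) (exp (-s)) := by
  induction v with
  | zero => simp [etaPartialSum]
  | succ v ih =>
    obtain ⟨h1, h2⟩ := ih
    have hv : (0 : ℝ) ≤ v := v.cast_nonneg
    have e1 : exp (-(s * (6 * (v + 1) + 1) ^ 2)) ≤ exp (-(s * (6 * v + 1) ^ 2)) :=
      exp_le_exp.2 <| neg_le_neg <| mul_le_mul_of_nonneg_left (by nlinarith) hs
    have e2 : exp (-(s * (6 * (v + 1) - 1) ^ 2)) ≤ exp (-(s * (6 * v - 1) ^ 2)) :=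
      exp_le_exp.2 <| neg_le_neg <| mul_le_mul_of_nonneg_left (by nlinarith) hs
    have hσ : (-1 : ℝ) ^ v * (-1) ^ v = 1 := by rw [← mul_pow]; norm_num
    have key : (-1) ^ (v + 1) * etaPartialSum (v + 1) s =
        -((-1) ^ v * etaPartialSum v s) +
          (exp (-(s * (6 * (v + 1) + 1) ^ 2)) + exp (-(s * (6 * (v + 1) - 1) ^ 2))) := by
      rw [etaPartialSum_succ, pow_succ]
      linear_combination
        (exp (-(s * (6 * (v + 1) + 1) ^ 2)) + exp (-(s * (6 * (v + 1) - 1) ^ 2))) * hσ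
    rw [key]
    push_cast
    constructor <;> linarith

lemma abs_etaPartialSum_le {s : ℝ} (hs : 0 ≤ s) (v : ℕ) : |etaPartialSum v s| ≤ exp (-s) := by
  obtain ⟨h1, h2⟩ := neg_one_pow_mul_etaPartialSum_mem hs v
  have h : |(-1) ^ v * etaPartialSum v s| ≤ exp (-s) := by
    refine abs_le.2 ⟨?_, h2⟩
    linarith [exp_pos (-(s * (6 * (v : ℝ) + 1) ^ 2)), exp_pos (-(s * (6 * (v : ℝ) - 1) ^ 2))]
  simpa [abs_mul] using h

lemma continuous_etaPartialSum (v : ℕ) : Continuous (etaPartialSum v) := by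
  unfold etaPartialSum
  fun_prop

end Eta

section Laplace

open MeasureTheory Set

lemma integrableOn_mul_exp_neg_mul {X : ℝ} (hX : 0 < X) :
    IntegrableOn (fun t => t * exp (-(X * t))) (Ioi 0) := by
  simpa using integrableOn_rpow_mul_exp_neg_mul_rpow (s := 1) (p := 1) (by norm_num) one_pos hX

lemma integral_mul_exp_neg_mul {X : ℝ} (hX : 0 < X) :
    ∫ t in Ioi 0, t * exp (-(X * t)) = 1 / X ^ 2 := by
  have h := integral_rpow_mul_exp_neg_mul_Ioi two_pos hX
  norm_num at h
  simpa using h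

lemma boxSum_eq_integral {a b c d : ℝ} (ha : 0 < a) (hb : 0 < b) (hc : 0 < c) (hd : 0 < d)
    (v : ℕ) :
    boxSum a b c d v = ∫ t in Ioi 0, t * (etaPartialSum v (a * t) * etaPartialSum v (b * t) *
      etaPartialSum v (c * t) * etaPartialSum v (d * t)) := by
  have pos (x : ℝ) (hx : 0 < x) (n : ℤ) : 0 < x * ((6 * n + 1 : ℤ) : ℝ) ^ 2 := by
    have : ((6 * n + 1 : ℤ) : ℝ) ≠ 0 := by exact_mod_cast (by omega : 6 * n + 1 ≠ 0)
    positivity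
  have hX (n₁ n₂ n₃ n₄ : ℤ) : 0 < a * ((6 * n₁ + 1 : ℤ) : ℝ) ^ 2 + b * ((6 * n₂ + 1 : ℤ) : ℝ) ^ 2 +
      c * ((6 * n₃ + 1 : ℤ) : ℝ) ^ 2 + d * ((6 * n₄ + 1 : ℤ) : ℝ) ^ 2 := by
    linarith [pos a ha n₁, pos b hb n₂, pos c hc n₃, pos d hd n₄]
  have hint (n₁ n₂ n₃ n₄ : ℤ) := (integrableOn_mul_exp_neg_mul (hX n₁ n₂ n₃ n₄)).const_mul
    ((-1 : ℝ) ^ (n₁ + n₂ + n₃ + n₄))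
  have hterm (n₁ n₂ n₃ n₄ : ℤ) := (integral_const_mul ((-1 : ℝ) ^ (n₁ + n₂ + n₃ + n₄)) _).trans
    (congrArg _ (integral_mul_exp_neg_mul (hX n₁ n₂ n₃ n₄)))
  simp only [mul_one_div] at hterm
  simp only [boxSum, ← hterm]
  simp_rw [← integral_finsetSum _ fun n₄ _ => hint _ _ _ n₄]
  simp_rw [← integral_finsetSum _ fun n₃ _ => integrable_finsetSum _ fun n₄ _ => hint _ _ n₃ n₄]
  simp_rw [← integral_finsetSum _ fun n₂ _ => integrable_finsetSum _ fun n₃ _ =>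
    integrable_finsetSum _ fun n₄ _ => hint _ n₂ n₃ n₄]
  rw [← integral_finsetSum _ fun n₁ _ => integrable_finsetSum _ fun n₂ _ =>
    integrable_finsetSum _ fun n₃ _ => integrable_finsetSum _ fun n₄ _ => hint n₁ n₂ n₃ n₄]
  congr 1
  funext t
  have hfac (n₁ n₂ n₃ n₄ : ℤ) : (-1 : ℝ) ^ (n₁ + n₂ + n₃ + n₄) *
      (t * exp (-((a * ((6 * n₁ + 1 : ℤ) : ℝ) ^ 2 + b * ((6 * n₂ + 1 : ℤ) : ℝ) ^ 2 +
        c * ((6 * n₃ + 1 : ℤ) : ℝ) ^ 2 + d * ((6 * n₄ + 1 : ℤ) : ℝ) ^ 2) * t))) =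
      t * (((-1) ^ n₁ * exp (-(a * t * ((6 * n₁ + 1 : ℤ) : ℝ) ^ 2))) *
        (((-1) ^ n₂ * exp (-(b * t * ((6 * n₂ + 1 : ℤ) : ℝ) ^ 2))) *
        (((-1) ^ n₃ * exp (-(c * t * ((6 * n₃ + 1 : ℤ) : ℝ) ^ 2))) *
        ((-1) ^ n₄ * exp (-(d * t * ((6 * n₄ + 1 : ℤ) : ℝ) ^ 2)))))) := by
    simp only [add_mul, neg_add, exp_add, zpow_add₀ (neg_ne_zero.2 (one_ne_zero' ℝ)),
      mul_right_comm _ _ t]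
    ring
  simp_rw [hfac, ← Finset.mul_sum, ← Finset.sum_mul, etaPartialSum]
  ring

/-- If the product of eta functions attached to `a, b, c, d` is a Dirichlet-type series
`∑ C i * exp (-X i * t)`, then the box sums converge to its Mellin transform at `2`. -/
lemma tendsto_boxSum {ι : Type*} [Countable ι] {a b c d : ℝ} (ha : 0 < a) (hb : 0 < b) (hc : 0 < c)
    (hd : 0 < d) {C X : ι → ℝ} (hX : ∀ i, 0 < X i) (hs : Summable fun i => C i / X i ^ 2)
    (h : ∀ t : ℝ, 0 < t → HasSum (fun i => C i * exp (-(X i * t)))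
      (etaExp (a * t) * etaExp (b * t) * etaExp (c * t) * etaExp (d * t))) :
    Tendsto (boxSum a b c d) atTop (𝓝 (∑' i, C i / X i ^ 2)) := by
  have hint (i : ι) : IntegrableOn (fun t => C i * (t * exp (-(X i * t)))) (Ioi 0) :=
    (integrableOn_mul_exp_neg_mul (hX i)).const_mul _
  have hval (i : ι) : ∫ t in Ioi 0, C i * (t * exp (-(X i * t))) = C i / X i ^ 2 := by
    rw [integral_const_mul, integral_mul_exp_neg_mul (hX i), mul_one_div]
  have hnorm (i : ι) : ∫ t in Ioi 0, ‖C i * (t * exp (-(X i * t)))‖ = ‖C i / X i ^ 2‖ := by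
    rw [norm_div, norm_pow, norm_of_nonneg (hX i).le, ← mul_one_div,
      ← integral_mul_exp_neg_mul (hX i), ← integral_const_mul]
    refine setIntegral_congr_fun measurableSet_Ioi fun t ht => ?_
    simp only [norm_mul, norm_of_nonneg (le_of_lt ht), norm_of_nonneg (exp_pos _).le]
  have hsum := (hasSum_integral_of_summable_integral_norm hint
    (hs.norm.congr fun i => (hnorm i).symm)).tsum_eq
  simp only [hval] at hsum
  have hlim : ∫ t in Ioi 0, ∑' i, C i * (t * exp (-(X i * t))) =
      ∫ t in Ioi 0, t * (etaExp (a * t) * etaExp (b * t) * etaExp (c * t) * etaExp (d * t)) := by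
    refine setIntegral_congr_fun measurableSet_Ioi fun t ht => ?_
    simp only [← (h t ht).tsum_eq, ← tsum_mul_left, mul_left_comm]
  rw [hsum, hlim]
  simp_rw [funext (boxSum_eq_integral ha hb hc hd)]
  refine tendsto_integral_of_dominated_convergence (fun t => t * exp (-((a + b + c + d) * t)))
    (fun v => ?_) (integrableOn_mul_exp_neg_mul (by positivity)) (fun v => ?_) ?_
  · have := continuous_etaPartialSum v
    exact Continuous.aestronglyMeasurable (by fun_prop)
  · refine (ae_restrict_iff' measurableSet_Ioi).2 (.of_forall fun t (ht : 0 < t) => ?_)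
    have hle (r : ℝ) (hr : 0 < r) := abs_etaPartialSum_le (mul_pos hr ht).le v
    simp only [norm_mul, Real.norm_eq_abs, abs_of_pos ht]
    rw [show -((a + b + c + d) * t) = -(a * t) + -(b * t) + -(c * t) + -(d * t) by ring,
      exp_add, exp_add, exp_add]
    gcongr
    exacts [hle a ha, hle b hb, hle c hc, hle d hd]
  · refine (ae_restrict_iff' measurableSet_Ioi).2 (.of_forall fun t (ht : 0 < t) => ?_)
    have hr (r : ℝ) (hr : 0 < r) := tendsto_etaPartialSum (mul_pos hr ht)
    exact ((((hr a ha).mul (hr b hb)).mul (hr c hc)).mul (hr d hd)).const_mul t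

end Laplace

section Summability

lemma abs_div_quadratic_sq_le {α β : ℝ} (hα : 1 ≤ α) (hβ : 1 ≤ β) (m n : ℤ) (hm : m ≠ 0) :
    |(m : ℝ)| / (α * m ^ 2 + β * n ^ 2) ^ 2 ≤ ‖![m, n]‖ ^ (-3 : ℝ) := by
  have hM : ‖![m, n]‖ = max |(m : ℝ)| |(n : ℝ)| := by
    simp [EisensteinSeries.norm_eq_max_natAbs, Nat.cast_natAbs]
  have hm' : (0 : ℝ) < |(m : ℝ)| := by positivity
  rw [hM]
  set M := max |(m : ℝ)| |(n : ℝ)|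
  have hmM : |(m : ℝ)| ≤ M := le_max_left _ _
  have hM0 : 0 < M := hm'.trans_le hmM
  have hle : M ^ 2 ≤ α * m ^ 2 + β * n ^ 2 := by
    rcases max_choice |(m : ℝ)| |(n : ℝ)| with h | h <;> simp only [M, h, sq_abs] <;>
      nlinarith [sq_nonneg (m : ℝ), sq_nonneg (n : ℝ)]
  rw [show (-3 : ℝ) = -(3 : ℕ) by norm_num, rpow_neg hM0.le, rpow_natCast]
  calc |(m : ℝ)| / (α * m ^ 2 + β * n ^ 2) ^ 2 ≤ M / (M ^ 2) ^ 2 := by gcongr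
    _ = (M ^ 3)⁻¹ := by field_simp

lemma summable_mul_div_quadratic_sq {ι : Type*} {α β : ℝ} (hα : 1 ≤ α) (hβ : 1 ≤ β) {m n : ι → ℤ}
    (hinj : Function.Injective fun i => ![m i, n i]) (hm : ∀ i, m i ≠ 0) {ε : ι → ℝ}
    (hε : ∀ i, |ε i| = 1) :
    Summable fun i => ε i * m i / (α * (m i : ℝ) ^ 2 + β * (n i : ℝ) ^ 2) ^ 2 := by
  have hs := (EisensteinSeries.summable_one_div_norm_rpow (k := 3) (by norm_num)).comp_injective hinj
  refine hs.of_norm_bounded fun i => ?_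
  refine le_trans (le_of_eq ?_) (abs_div_quadratic_sq_le hα hβ (m i) (n i) (hm i))
  rw [Real.norm_eq_abs, abs_div, abs_mul, hε, one_mul, abs_pow, sq_abs]

lemma summable_f12term : Summable f12term := by
  refine (summable_mul_div_quadratic_sq (ι := ℤ × ℕ) le_rfl le_rfl (m := fun p => 2 * p.2 + 1)
    (n := fun p => 2 * p.1) (ε := fun p => (-1) ^ (p.1 + (p.2 : ℤ))) (fun p q h => ?_)
    (fun p => by omega) fun p => by simp).congr fun p => ?_
  · have h0 := congrFun h 0
    have h1 := congrFun h 1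
    simp at h0 h1
    exact Prod.ext h1 h0
  · rw [f12term]
    push_cast
    ring

lemma summable_f14term : Summable f14term := by
  refine (summable_mul_div_quadratic_sq (ι := ℤ × ℤ) (α := 4) (by norm_num) le_rfl
    (m := fun p => 3 * p.2 + 1) (n := fun p => 6 * p.1 + 1) (ε := fun p => (-1) ^ p.1)
    (fun p q h => ?_) (fun p => by omega) fun p => by simp).congr fun p => ?_
  · have h0 := congrFun h 0
    have h1 := congrFun h 1
    simp at h0 h1
    exact Prod.ext h1 h0
  · rw [f14term]
    push_cast
    ring

lemma summable_f22term : Summable f22term := by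
  refine (summable_mul_div_quadratic_sq (ι := ℕ × ℕ) (α := 2) (by norm_num) le_rfl
    (m := fun p => 2 * p.2 + 1) (n := fun p => 2 * p.1 + 1)
    (ε := fun p => (-1) ^ (p.1 * (p.1 + 1) / 2 + p.2))
    (fun p q h => ?_) (fun p => by omega) fun p => by simp).congr fun p => ?_
  · have h0 := congrFun h 0
    have h1 := congrFun h 1
    simp at h0 h1
    exact Prod.ext h1 h0
  · rw [f22term]
    push_cast
    ring

end Summability

section LatticeSums

lemma etaExp_natCast_mul (m : ℕ) (t : ℝ) :
    etaExp (m * t) = exp (-t) ^ m * eulerProd (exp (-(12 * t)) ^ (2 * m)) := by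
  rw [etaExp, ← exp_nat_mul, ← exp_nat_mul]
  push_cast
  ring_nf

lemma hasSum_etaExp_one_one_two_two {t : ℝ} (ht : 0 < t) :
    HasSum (fun p : ℤ × ℕ => (-1 : ℝ) ^ (p.1 + (p.2 : ℤ)) * (2 * (p.2 : ℝ) + 1) *
      exp (-(6 * ((2 * (p.2 : ℝ) + 1) ^ 2 + 4 * (p.1 : ℝ) ^ 2) * t)))
      (etaExp (1 * t) * etaExp (1 * t) * etaExp (2 * t) * etaExp (2 * t)) := by
  have e1 := etaExp_natCast_mul 1 t
  have e2 := etaExp_natCast_mul 2 t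
  norm_num only [Nat.cast_one, Nat.cast_ofNat] at e1 e2
  convert! (hasSum_eulerProd_one_one_two_two (exp_pos (-(12 * t)))
    (exp_lt_one_iff.2 (by linarith))).mul_left (exp (-t) ^ 6) using 1
  · funext p
    have key : exp (-(6 * ((2 * (p.2 : ℝ) + 1) ^ 2 + 4 * (p.1 : ℝ) ^ 2) * t)) =
        exp (-t) ^ 6 * exp (-(12 * t)) ^ (2 * p.1 ^ 2) *
          (exp (-(12 * t)) ^ 2) ^ (p.2 ^ 2 + p.2) := by
      rw [← pow_mul, exp_neg_twelve_mul_zpow, ← exp_nat_mul, ← exp_nat_mul, ← exp_add, ← exp_add]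
      push_cast
      ring_nf
    rw [key, zpow_add₀ (neg_ne_zero.2 (one_ne_zero' ℝ)), zpow_natCast]
    ring
  · simp only [e1, e2]
    ring

lemma hasSum_etaExp_one_one_four_four {t : ℝ} (ht : 0 < t) :
    HasSum (fun p : ℤ × ℤ => (-1 : ℝ) ^ p.1 * (3 * (p.2 : ℝ) + 1) *
      exp (-(2 * (4 * (3 * (p.2 : ℝ) + 1) ^ 2 + (6 * (p.1 : ℝ) + 1) ^ 2) * t)))
      (etaExp (1 * t) * etaExp (1 * t) * etaExp (4 * t) * etaExp (4 * t)) := by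
  have e1 := etaExp_natCast_mul 1 t
  have e4 := etaExp_natCast_mul 4 t
  norm_num only [Nat.cast_one, Nat.cast_ofNat] at e1 e4
  convert! (hasSum_eulerProd_one_one_four_four (exp_pos (-(12 * t)))
    (exp_lt_one_iff.2 (by linarith))).mul_left (exp (-t) ^ 10) using 1
  · funext p
    have key : exp (-(2 * (4 * (3 * (p.2 : ℝ) + 1) ^ 2 + (6 * (p.1 : ℝ) + 1) ^ 2) * t)) =
        exp (-t) ^ 10 * (exp (-(12 * t)) ^ 2) ^ (3 * p.1 ^ 2 + p.1) *
          exp (-(12 * t)) ^ (6 * p.2 ^ 2 + 4 * p.2) := by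
      rw [← zpow_natCast (exp (-(12 * t))), ← zpow_mul, exp_neg_twelve_mul_zpow,
        exp_neg_twelve_mul_zpow, ← exp_nat_mul, ← exp_add, ← exp_add]
      push_cast
      ring_nf
    rw [key]
    ring
  · simp only [e1, e4]
    ring

lemma hasSum_etaExp_one_two_two_four {t : ℝ} (ht : 0 < t) :
    HasSum (fun p : ℕ × ℕ => (-1 : ℝ) ^ (p.1 * (p.1 + 1) / 2 + p.2) * (2 * (p.2 : ℝ) + 1) *
      exp (-(3 * (2 * (2 * (p.2 : ℝ) + 1) ^ 2 + (2 * (p.1 : ℝ) + 1) ^ 2) * t)))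
      (etaExp (1 * t) * etaExp (2 * t) * etaExp (2 * t) * etaExp (4 * t)) := by
  have e1 := etaExp_natCast_mul 1 t
  have e2 := etaExp_natCast_mul 2 t
  have e4 := etaExp_natCast_mul 4 t
  norm_num only [Nat.cast_one, Nat.cast_ofNat] at e1 e2 e4
  convert! (hasSum_eulerProd_one_two_two_four (exp_pos (-(12 * t)))
    (exp_lt_one_iff.2 (by linarith))).mul_left (exp (-t) ^ 9) using 1
  · funext p
    have key : exp (-(3 * (2 * (2 * (p.2 : ℝ) + 1) ^ 2 + (2 * (p.1 : ℝ) + 1) ^ 2) * t)) =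
        exp (-t) ^ 9 * exp (-(12 * t)) ^ (p.1 ^ 2 + p.1) *
          (exp (-(12 * t)) ^ 2) ^ (p.2 ^ 2 + p.2) := by
      rw [← pow_mul, ← exp_nat_mul, ← exp_nat_mul, ← exp_nat_mul, ← exp_add, ← exp_add]
      push_cast
      ring_nf
    rw [key, pow_add (-1 : ℝ)]
    ring
  · simp only [e1, e2, e4]
    ring

lemma tendsto_boxSum_one_one_two_two :
    Tendsto (boxSum 1 1 2 2) atTop (𝓝 ((∑' p, f12term p) / 36)) := by
  have hterm (p : ℤ × ℕ) : (-1 : ℝ) ^ (p.1 + (p.2 : ℤ)) * (2 * (p.2 : ℝ) + 1) /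
      (6 * ((2 * (p.2 : ℝ) + 1) ^ 2 + 4 * (p.1 : ℝ) ^ 2)) ^ 2 = f12term p / 36 := by
    rw [f12term, mul_pow, div_div, mul_comm (_ ^ 2)]
    norm_num
  rw [← tsum_div_const, ← tsum_congr hterm]
  exact tendsto_boxSum one_pos one_pos two_pos two_pos (fun p => by positivity)
    (by simpa only [hterm] using summable_f12term.div_const 36)
    fun t ht => hasSum_etaExp_one_one_two_two ht

lemma tendsto_boxSum_one_one_four_four :
    Tendsto (boxSum 1 1 4 4) atTop (𝓝 ((∑' p, f14term p) / 4)) := by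
  have hterm (p : ℤ × ℤ) : (-1 : ℝ) ^ p.1 * (3 * (p.2 : ℝ) + 1) /
      (2 * (4 * (3 * (p.2 : ℝ) + 1) ^ 2 + (6 * (p.1 : ℝ) + 1) ^ 2)) ^ 2 = f14term p / 4 := by
    rw [f14term, mul_pow, div_div, mul_comm (_ ^ 2)]
    norm_num
  have hpos (p : ℤ × ℤ) :
      0 < 2 * (4 * (3 * (p.2 : ℝ) + 1) ^ 2 + (6 * (p.1 : ℝ) + 1) ^ 2) := by
    have : 3 * (p.2 : ℝ) + 1 ≠ 0 := by exact_mod_cast (by omega : 3 * p.2 + 1 ≠ 0)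
    positivity
  rw [← tsum_div_const, ← tsum_congr hterm]
  exact tendsto_boxSum one_pos one_pos four_pos four_pos hpos
    (by simpa only [hterm] using summable_f14term.div_const 4)
    fun t ht => hasSum_etaExp_one_one_four_four ht

lemma tendsto_boxSum_one_two_two_four :
    Tendsto (boxSum 1 2 2 4) atTop (𝓝 ((∑' p, f22term p) / 9)) := by
  have hterm (p : ℕ × ℕ) : (-1 : ℝ) ^ (p.1 * (p.1 + 1) / 2 + p.2) * (2 * (p.2 : ℝ) + 1) /
      (3 * (2 * (2 * (p.2 : ℝ) + 1) ^ 2 + (2 * (p.1 : ℝ) + 1) ^ 2)) ^ 2 = f22term p / 9 := by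
    rw [f22term, mul_pow, div_div, mul_comm (_ ^ 2)]
    norm_num
  rw [← tsum_div_const, ← tsum_congr hterm]
  exact tendsto_boxSum one_pos two_pos two_pos four_pos (fun p => by positivity)
    (by simpa only [hterm] using summable_f22term.div_const 9)
    fun t ht => hasSum_etaExp_one_two_two_four ht

end LatticeSums

/-- `F(1,2) = F(1,1,2,2)`, `F(1,4) = F(1,1,4,4)` and `F(2,2) = F(1,2,2,4)` reduce to
two-dimensional (absolutely convergent) sums. -/
theorem stmt_0 :
    (Summable f12term ∧
      Tendsto (fun v => (1+1+2+2:ℝ)^2 * boxSum 1 1 2 2 v) atTop (𝓝 (∑' p, f12term p))) ∧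
    (Summable f14term ∧
      Tendsto (fun v => (1+1+4+4:ℝ)^2 * boxSum 1 1 4 4 v) atTop (𝓝 (25 * ∑' p, f14term p))) ∧
    (Summable f22term ∧
      Tendsto (fun v => (1+2+2+4:ℝ)^2 * boxSum 1 2 2 4 v) atTop (𝓝 (9 * ∑' p, f22term p))) := by
  refine ⟨⟨summable_f12term, ?_⟩, ⟨summable_f14term, ?_⟩, ⟨summable_f22term, ?_⟩⟩
  · convert! tendsto_boxSum_one_one_two_two.const_mul ((1+1+2+2:ℝ)^2) using 2
    ring
  · convert! tendsto_boxSum_one_one_four_four.const_mul ((1+1+4+4:ℝ)^2) using 2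
    ring
  · convert! tendsto_boxSum_one_two_two_four.const_mul ((1+2+2+4:ℝ)^2) using 2
    ring
end

section
/- For every real x > 0, with q = e^{−πx}, one has F_{(1,2)}(x) = −(π²/(32x)) · ( log q + 4 Σ_{k=1}^∞ k·χ₋₄(k)·log(1 + q^k) ). -/
open Real Filter Topology

/-- The two-dimensional lattice sum `F_{(1,2)}(x)`. -/
noncomputable def F12 (x : ℝ) : ℝ :=
  ∑' p : ℤ × ℕ, (-1:ℝ)^(p.1 + (p.2:ℤ)) * (2*(p.2:ℝ)+1) /
    ((2*(p.2:ℝ)+1)^2 + 4*x^2*(p.1:ℝ)^2)^2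

/-- The odd Dirichlet character modulo 4. -/
noncomputable def chi4 (k : ℕ) : ℝ := if k % 4 = 1 then 1 else if k % 4 = 3 then -1 else 0

lemma abs_chi4_le_one (k : ℕ) : |chi4 k| ≤ 1 := by
  unfold chi4
  split_ifs <;> simp

lemma chi4_two_mul (k : ℕ) : chi4 (2 * k) = 0 := by
  unfold chi4
  rw [if_neg (by omega), if_neg (by omega)]

lemma chi4_two_mul_add_one (k : ℕ) : chi4 (2 * k + 1) = (-1) ^ k := by
  unfold chi4
  rcases Nat.even_or_odd k with h | h
  · rw [if_pos (by grind), h.neg_one_pow]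
  · rw [if_neg (by grind), if_pos (by grind), h.neg_one_pow]

lemma I_pow_sub_neg_I_pow (n : ℕ) :
    Complex.I ^ n - (-Complex.I) ^ n = 2 * Complex.I * (chi4 n : ℂ) := by
  obtain ⟨k, rfl | rfl⟩ := Nat.even_or_odd' n
  · simp [chi4_two_mul, pow_mul]
  · simp [chi4_two_mul_add_one, pow_succ, pow_mul]
    ring

lemma div_sq_add_sq_sq_le {a b : ℝ} (ha : 0 < a) (hb : 0 < b) :
    a / (a ^ 2 + b ^ 2) ^ 2 ≤ a ^ (-(3 / 2) : ℝ) * b ^ (-(3 / 2) : ℝ) := by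
  have hD : 0 < a ^ 2 + b ^ 2 := by positivity
  rw [div_le_iff₀ (by positivity)]
  have h₁ : a ^ (5 / 2 : ℝ) ≤ (a ^ 2 + b ^ 2) ^ (5 / 4 : ℝ) := by
    calc a ^ (5 / 2 : ℝ) = (a ^ 2) ^ (5 / 4 : ℝ) := by
          rw [← Real.rpow_natCast, ← Real.rpow_mul ha.le]; norm_num
      _ ≤ _ := by gcongr; nlinarith
  have h₂ : b ^ (3 / 2 : ℝ) ≤ (a ^ 2 + b ^ 2) ^ (3 / 4 : ℝ) := by
    calc b ^ (3 / 2 : ℝ) = (b ^ 2) ^ (3 / 4 : ℝ) := by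
          rw [← Real.rpow_natCast, ← Real.rpow_mul hb.le]; norm_num
      _ ≤ _ := by gcongr; nlinarith
  calc a = a ^ (-(3 / 2) : ℝ) * b ^ (-(3 / 2) : ℝ) * (a ^ (5 / 2 : ℝ) * b ^ (3 / 2 : ℝ)) := by
        rw [mul_mul_mul_comm, ← Real.rpow_add ha, ← Real.rpow_add hb]; norm_num
    _ ≤ a ^ (-(3 / 2) : ℝ) * b ^ (-(3 / 2) : ℝ) *
        ((a ^ 2 + b ^ 2) ^ (5 / 4 : ℝ) * (a ^ 2 + b ^ 2) ^ (3 / 4 : ℝ)) := by gcongr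
    _ = _ := by rw [← Real.rpow_add hD]; norm_num

lemma div_sq_sq_le {a : ℝ} (ha : 1 ≤ a) : a / (a ^ 2) ^ 2 ≤ a ^ (-(3 / 2) : ℝ) := by
  have ha0 : 0 < a := by linarith
  calc a / (a ^ 2) ^ 2 = a ^ (-3 : ℝ) := by
        rw [Real.rpow_neg ha0.le, show (3 : ℝ) = (3 : ℕ) by norm_num, Real.rpow_natCast]
        field_simp
    _ ≤ _ := Real.rpow_le_rpow_of_exponent_le ha (by norm_num)

lemma summable_lattice {x : ℝ} (hx : 0 < x) :
    Summable fun p : ℤ × ℕ => (-1:ℝ)^(p.1 + (p.2:ℤ)) * (2*(p.2:ℝ)+1) /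
      ((2*(p.2:ℝ)+1)^2 + 4*x^2*(p.1:ℝ)^2)^2 := by
  have hk : Summable fun k : ℕ => (2 * (k : ℝ) + 1) ^ (-(3 / 2) : ℝ) := by
    have h := (Real.summable_nat_rpow (p := -(3 / 2))).2 (by norm_num)
    refine (h.comp_injective (i := fun k : ℕ => 2 * k + 1) fun a b hab => by grind).congr ?_
    intro k
    simp
  have hn : Summable fun n : ℤ => (2 * x) ^ (-(3 / 2) : ℝ) * |(n : ℝ)| ^ (-(3 / 2) : ℝ) +
      if n = 0 then 1 else 0 :=
    ((Real.summable_abs_int_rpow (by norm_num)).mul_left _).add (hasSum_ite_eq 0 1).summable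
  refine (hn.mul_of_nonneg hk (fun n => ?_) (fun k => ?_)).of_norm_bounded ?_
  · simp only [Pi.zero_apply]
    positivity
  · simp only [Pi.zero_apply]
    positivity
  rintro ⟨n, k⟩
  have ha : (1 : ℝ) ≤ 2 * (k : ℝ) + 1 := by linarith [(Nat.cast_nonneg k : (0 : ℝ) ≤ k)]
  have ha0 : (0 : ℝ) < 2 * (k : ℝ) + 1 := by linarith
  have hD : (0 : ℝ) ≤ (2 * (k : ℝ) + 1) ^ 2 + 4 * x ^ 2 * (n : ℝ) ^ 2 := by positivity
  simp only [norm_div, norm_mul, norm_zpow, norm_neg, norm_one, one_zpow, one_mul, norm_pow,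
    Real.norm_of_nonneg hD, Real.norm_of_nonneg ha0.le]
  rcases eq_or_ne n 0 with rfl | h0
  · have := div_sq_sq_le ha
    simpa [Real.zero_rpow (show -(3 / 2 : ℝ) ≠ 0 by norm_num)] using this
  · have hb : 0 < 2 * x * |(n : ℝ)| := by positivity
    have := div_sq_add_sq_sq_le ha0 hb
    rw [Real.mul_rpow (by positivity) (by positivity)] at this
    rw [if_neg h0, add_zero]
    rw [show 4 * x ^ 2 * (n : ℝ) ^ 2 = (2 * x * |(n : ℝ)|) ^ 2 by
      rw [mul_pow, sq_abs]; ring, mul_comm (_ * _) ((2 * (k : ℝ) + 1) ^ (-(3 / 2) : ℝ))]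
    exact this

lemma hasSum_one_div_add_int_sq {z : ℂ} (hz : 0 < z.im) :
    HasSum (fun n : ℤ => 1 / (z + n) ^ 2)
      (-(4 * (π : ℂ) ^ 2) * ∑' n : ℕ, (n : ℂ) * Complex.exp (2 * π * Complex.I * z) ^ n) := by
  have hs : Summable fun n : ℤ => 1 / (z + n) ^ 2 := by
    refine (EisensteinSeries.linear_right_summable z 1 (k := 2) le_rfl).congr fun n => ?_
    simp [zpow_ofNat]
  have h := EisensteinSeries.qExpansion_identity le_rfl (⟨z, hz⟩ : UpperHalfPlane)
  convert hs.hasSum using 1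
  have hc : (-2 * (π : ℂ) * Complex.I) ^ (1 + 1) / (Nat.factorial 1 : ℂ) =
      -(4 * (π : ℂ) ^ 2) := by
    simp only [Nat.factorial_one, Nat.cast_one, div_one, Nat.reduceAdd, mul_pow, Complex.I_sq]
    ring
  rw [hc] at h
  simpa using h.symm

lemma cexp_quarter (b : ℝ) :
    Complex.exp (2 * π * Complex.I * ((1 + b * Complex.I) / 4)) =
      Complex.I * (Real.exp (-(π * b / 2)) : ℂ) := by
  rw [show 2 * π * Complex.I * ((1 + b * Complex.I) / 4) =
    π / 2 * Complex.I + ((-(π * b / 2) : ℝ) : ℂ) by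
      push_cast; linear_combination (π * b / 2 : ℂ) * Complex.I_sq,
    Complex.exp_add, Complex.exp_pi_div_two_mul_I, Complex.ofReal_exp]

lemma cexp_three_quarters (b : ℝ) :
    Complex.exp (2 * π * Complex.I * ((3 + b * Complex.I) / 4)) =
      -Complex.I * (Real.exp (-(π * b / 2)) : ℂ) := by
  rw [show 2 * π * Complex.I * ((3 + b * Complex.I) / 4) =
    2 * π * Complex.I * ((1 + b * Complex.I) / 4) + π * Complex.I by ring,
    Complex.exp_add, Complex.exp_pi_mul_I, cexp_quarter]
  ring

lemma one_div_add_sq_sub_one_div_sub_sq {a b : ℝ} (ha : 0 < a) :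
    1 / ((a : ℂ) + b * Complex.I) ^ 2 - 1 / ((a : ℂ) - b * Complex.I) ^ 2 =
      -(4 * b * Complex.I) * ((a / (a ^ 2 + b ^ 2) ^ 2 : ℝ) : ℂ) := by
  have h₁ : (a : ℂ) + b * Complex.I ≠ 0 := fun h => by
    simpa [ha.ne'] using congrArg Complex.re h
  have h₂ : (a : ℂ) - b * Complex.I ≠ 0 := fun h => by
    simpa [ha.ne'] using congrArg Complex.re h
  have h₃ : (a : ℂ) ^ 2 + b ^ 2 = (a + b * Complex.I) * (a - b * Complex.I) := by
    linear_combination (b : ℂ) ^ 2 * Complex.I_sq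
  rw [Complex.ofReal_div, Complex.ofReal_pow, Complex.ofReal_add, Complex.ofReal_pow,
    Complex.ofReal_pow, h₃, mul_pow, div_sub_div _ _ (pow_ne_zero 2 h₁) (pow_ne_zero 2 h₂),
    mul_div_assoc']
  congr 1
  ring

/-- The partial fraction expansion of `sech · tanh`, written as a Lambert-type series. -/
lemma tsum_alternating_odd_eq {b : ℝ} (hb : 0 < b)
    (hs : Summable fun k : ℕ => (-1 : ℝ) ^ k * (2 * (k : ℝ) + 1) /
      ((2 * (k : ℝ) + 1) ^ 2 + b ^ 2) ^ 2) :
    ∑' k : ℕ, (-1 : ℝ) ^ k * (2 * (k : ℝ) + 1) / ((2 * (k : ℝ) + 1) ^ 2 + b ^ 2) ^ 2 =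
      π ^ 2 / (8 * b) * ∑' n : ℕ, (n : ℝ) * chi4 n * Real.exp (-(π * b / 2)) ^ n := by
  set t : ℕ → ℝ := fun k => (-1 : ℝ) ^ k * (2 * (k : ℝ) + 1) /
    ((2 * (k : ℝ) + 1) ^ 2 + b ^ 2) ^ 2 with ht
  set u := Real.exp (-(π * b / 2)) with hu
  have hu1 : |u| < 1 := by
    rw [abs_of_pos (Real.exp_pos _), Real.exp_lt_one_iff]
    have := Real.pi_pos
    have : 0 < π * b / 2 := by positivity
    linarith
  have hz : 0 < ((1 + b * Complex.I) / 4 : ℂ).im := by simpa using hb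
  have hw : 0 < ((3 + b * Complex.I) / 4 : ℂ).im := by simpa using hb
  have hsumZ :=
    ((hasSum_one_div_add_int_sq hz).sub (hasSum_one_div_add_int_sq hw)).nat_add_neg_add_one
  rw [cexp_quarter, cexp_three_quarters] at hsumZ
  have hpair : HasSum (fun m : ℕ => t (2 * m) + t (2 * m + 1)) (∑' k, t k) := by
    have he := hs.comp_injective (i := fun m : ℕ => 2 * m) fun _ _ h => by grind
    have ho := hs.comp_injective (i := fun m : ℕ => 2 * m + 1) fun _ _ h => by grind
    rw [(he.hasSum.even_add_odd ho.hasSum).tsum_eq]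
    exact he.hasSum.add ho.hasSum
  have hpair' := (Complex.hasSum_ofReal.2 hpair).mul_left (-(64 * b * Complex.I))
  have hterm (m : ℕ) : -(64 * b * Complex.I) * ((t (2 * m) + t (2 * m + 1) : ℝ) : ℂ) =
      1 / ((1 + b * Complex.I) / 4 + ((m : ℤ) : ℂ)) ^ 2 -
        1 / ((3 + b * Complex.I) / 4 + ((m : ℤ) : ℂ)) ^ 2 +
      (1 / ((1 + b * Complex.I) / 4 + ((-((m : ℤ) + 1) : ℤ) : ℂ)) ^ 2 -
        1 / ((3 + b * Complex.I) / 4 + ((-((m : ℤ) + 1) : ℤ) : ℂ)) ^ 2) := by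
    have h₁ := one_div_add_sq_sub_one_div_sub_sq (a := 4 * m + 1) (b := b) (by positivity)
    have h₃ := one_div_add_sq_sub_one_div_sub_sq (a := 4 * m + 3) (b := b) (by positivity)
    have e₁ : t (2 * m) = (4 * m + 1) / ((4 * m + 1) ^ 2 + b ^ 2) ^ 2 := by
      simp only [ht, pow_mul, Nat.cast_mul, Nat.cast_ofNat, neg_one_sq, one_pow, one_mul]
      ring_nf
    have e₃ : t (2 * m + 1) = -((4 * m + 3) / ((4 * m + 3) ^ 2 + b ^ 2) ^ 2) := by
      simp only [ht, pow_succ, pow_mul]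
      push_cast
      ring_nf
    have q (z : ℂ) : 1 / (z / 4) ^ 2 = 16 * (1 / z ^ 2) := by
      rw [div_pow]; norm_num; ring
    rw [e₁, e₃, Complex.ofReal_add, Complex.ofReal_neg]
    rw [show (1 + b * Complex.I) / 4 + ((m : ℤ) : ℂ) =
          (((4 * m + 1 : ℝ) : ℂ) + b * Complex.I) / 4 by push_cast; ring,
      show (3 + b * Complex.I) / 4 + ((m : ℤ) : ℂ) =
          (((4 * m + 3 : ℝ) : ℂ) + b * Complex.I) / 4 by push_cast; ring,
      show (1 + b * Complex.I) / 4 + ((-((m : ℤ) + 1) : ℤ) : ℂ) =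
          -(((4 * m + 3 : ℝ) : ℂ) - b * Complex.I) / 4 by push_cast; ring,
      show (3 + b * Complex.I) / 4 + ((-((m : ℤ) + 1) : ℤ) : ℂ) =
          -(((4 * m + 1 : ℝ) : ℂ) - b * Complex.I) / 4 by push_cast; ring,
      q, q, q, q, neg_sq, neg_sq]
    linear_combination -16 * h₁ + 16 * h₃
  have hT := (hpair'.congr_fun fun m => (hterm m).symm).unique hsumZ
  have hsum (c : ℂ) (hc : ‖c‖ = 1) : Summable fun n : ℕ => (n : ℂ) * (c * (u : ℂ)) ^ n := by
    have := summable_pow_mul_geometric_of_norm_lt_one 1 (r := c * (u : ℂ))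
      (by simpa [hc] using hu1)
    simpa using this
  have hdiff : ∑' n : ℕ, (n : ℂ) * (Complex.I * (u : ℂ)) ^ n -
      ∑' n : ℕ, (n : ℂ) * (-Complex.I * (u : ℂ)) ^ n =
      2 * Complex.I * ((∑' n : ℕ, (n : ℝ) * chi4 n * u ^ n : ℝ) : ℂ) := by
    rw [← (hsum _ (by simp)).tsum_sub (hsum _ (by simp)), Complex.ofReal_tsum, ← tsum_mul_left]
    refine tsum_congr fun n => ?_
    rw [mul_pow, mul_pow]
    push_cast
    linear_combination (n : ℂ) * (u : ℂ) ^ n * I_pow_sub_neg_I_pow n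
  have hfin : (b : ℂ) * 8 * ((∑' k, t k : ℝ) : ℂ) =
      (π : ℂ) ^ 2 * ((∑' n : ℕ, (n : ℝ) * chi4 n * u ^ n : ℝ) : ℂ) := by
    refine mul_left_cancel₀ (mul_ne_zero (by norm_num : (-8 : ℂ) ≠ 0) Complex.I_ne_zero) ?_
    linear_combination hT - 4 * (π : ℂ) ^ 2 * hdiff
  have hreal : b * 8 * ∑' k, t k = π ^ 2 * ∑' n : ℕ, (n : ℝ) * chi4 n * u ^ n := by
    exact_mod_cast hfin
  rw [div_mul_eq_mul_div, ← hreal]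
  field_simp

lemma hasSum_alternating_odd_cube :
    HasSum (fun k : ℕ => (-1 : ℝ) ^ k * (2 * (k : ℝ) + 1) / ((2 * (k : ℝ) + 1) ^ 2) ^ 2)
      (π ^ 3 / 32) := by
  have hinj : Function.Injective fun k : ℕ => 2 * k + 1 := fun _ _ h => by grind
  have h := (hinj.hasSum_iff ?_).2 hasSum_L_function_mod_four_eval_three
  · refine h.congr_fun fun k => ?_
    have hsin : Real.sin (π * ((2 * k + 1 : ℕ) : ℝ) / 2) = (-1) ^ k := by
      rw [show π * ((2 * k + 1 : ℕ) : ℝ) / 2 = π / 2 + k * π by push_cast; ring,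
        Real.sin_add_nat_mul_pi, Real.sin_pi_div_two, mul_one]
    have : (2 * (k : ℝ) + 1) ≠ 0 := by positivity
    simp only [Function.comp_apply, hsin]
    push_cast
    field_simp
  · intro n hn
    obtain ⟨k, rfl | rfl⟩ := Nat.even_or_odd' n
    · rw [show π * ((2 * k : ℕ) : ℝ) / 2 = k * π by push_cast; ring, Real.sin_nat_mul_pi, mul_zero]
    · exact absurd ⟨k, rfl⟩ hn

lemma summable_nat_mul_pow {q : ℝ} (hq0 : 0 < q) (hq1 : q < 1) :
    Summable fun k : ℕ => (k : ℝ) * q ^ k := by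
  simpa using summable_pow_mul_geometric_of_norm_lt_one 1 (r := q)
    (by rwa [Real.norm_of_nonneg hq0.le])

lemma summable_lambert {q : ℝ} (hq0 : 0 < q) (hq1 : q < 1) :
    Summable fun p : ℕ × ℕ =>
      (p.1 : ℝ) * chi4 p.1 * ((-(q ^ p.1)) ^ (p.2 + 1) / ((p.2 : ℝ) + 1)) := by
  have h := (summable_nat_mul_pow hq0 hq1).mul_of_nonneg
    (summable_geometric_of_lt_one hq0.le hq1) (fun k => by simp only [Pi.zero_apply]; positivity)
    (fun n => by simp only [Pi.zero_apply]; positivity)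
  refine h.of_norm_bounded ?_
  rintro ⟨k, n⟩
  rcases Nat.eq_zero_or_pos k with rfl | hk
  · simp
  have hn : (1 : ℝ) ≤ (n : ℝ) + 1 := by linarith [(Nat.cast_nonneg n : (0 : ℝ) ≤ n)]
  simp only [norm_mul, norm_div, norm_pow, norm_neg, Real.norm_of_nonneg hq0.le,
    Real.norm_natCast, Real.norm_of_nonneg (zero_le_one.trans hn), Real.norm_eq_abs (chi4 k)]
  calc (k : ℝ) * |chi4 k| * ((q ^ k) ^ (n + 1) / ((n : ℝ) + 1))
      ≤ (k : ℝ) * 1 * ((q ^ k) ^ (n + 1) / 1) := by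
        gcongr
        exact abs_chi4_le_one k
    _ = (k : ℝ) * q ^ (k * (n + 1)) := by rw [mul_one, div_one, pow_mul]
    _ ≤ (k : ℝ) * q ^ (k + n) := by
        refine mul_le_mul_of_nonneg_left (pow_le_pow_of_le_one hq0.le hq1.le ?_) (by positivity)
        nlinarith
    _ = (k : ℝ) * q ^ k * q ^ n := by rw [pow_add, mul_assoc]

lemma hasSum_lambert_log {q : ℝ} (hq0 : 0 < q) (hq1 : q < 1) (k : ℕ) :
    HasSum (fun n : ℕ => (k : ℝ) * chi4 k * ((-(q ^ k)) ^ (n + 1) / ((n : ℝ) + 1)))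
      (-((k : ℝ) * chi4 k * Real.log (1 + q ^ k))) := by
  rcases Nat.eq_zero_or_pos k with rfl | hk
  · simp [hasSum_zero]
  have h := Real.hasSum_pow_div_log_of_abs_lt_one (x := -(q ^ k)) (by
    rw [abs_neg, abs_of_pos (by positivity)]
    exact pow_lt_one₀ hq0.le hq1 hk.ne')
  simpa [mul_neg] using h.mul_left ((k : ℝ) * chi4 k)

lemma hasSum_lattice_row_succ {x : ℝ} (hx : 0 < x) (n : ℕ)
    (hs : Summable fun k : ℕ => (-1 : ℝ) ^ k * (2 * (k : ℝ) + 1) /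
      ((2 * (k : ℝ) + 1) ^ 2 + 4 * x ^ 2 * ((n : ℝ) + 1) ^ 2) ^ 2) :
    HasSum (fun k : ℕ => (-1 : ℝ) ^ (((n : ℤ) + 1) + (k : ℤ)) * (2 * (k : ℝ) + 1) /
      ((2 * (k : ℝ) + 1) ^ 2 + 4 * x ^ 2 * ((n : ℝ) + 1) ^ 2) ^ 2)
      (π ^ 2 / (16 * x) * ∑' k : ℕ, (k : ℝ) * chi4 k *
        ((-(Real.exp (-π * x) ^ k)) ^ (n + 1) / ((n : ℝ) + 1))) := by
  have hb : 0 < 2 * x * ((n : ℝ) + 1) := by positivity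
  have e : 4 * x ^ 2 * ((n : ℝ) + 1) ^ 2 = (2 * x * ((n : ℝ) + 1)) ^ 2 := by ring
  rw [e] at hs ⊢
  have h := hs.hasSum
  rw [tsum_alternating_odd_eq hb hs] at h
  have hexp : Real.exp (-(π * (2 * x * ((n : ℝ) + 1)) / 2)) = Real.exp (-π * x) ^ (n + 1) := by
    rw [← Real.exp_nat_mul]
    congr 1
    push_cast
    ring
  have hn : (n : ℝ) + 1 ≠ 0 := by positivity
  have hval : π ^ 2 / (16 * x) * ∑' k : ℕ, (k : ℝ) * chi4 k *
        ((-(Real.exp (-π * x) ^ k)) ^ (n + 1) / ((n : ℝ) + 1)) =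
      (-1) ^ (n + 1) * (π ^ 2 / (8 * (2 * x * ((n : ℝ) + 1))) *
        ∑' k : ℕ, (k : ℝ) * chi4 k * Real.exp (-(π * (2 * x * ((n : ℝ) + 1)) / 2)) ^ k) := by
    rw [← tsum_mul_left, ← tsum_mul_left, ← tsum_mul_left]
    refine tsum_congr fun k => ?_
    rw [hexp, neg_pow (Real.exp (-π * x) ^ k), ← pow_mul, ← pow_mul, mul_comm (n + 1) k]
    field_simp
    ring
  rw [hval]
  refine (h.mul_left ((-1 : ℝ) ^ (n + 1))).congr_fun fun k => ?_
  rw [show ((n : ℤ) + 1) + (k : ℤ) = ((n + 1 + k : ℕ) : ℤ) by push_cast; ring, zpow_natCast,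
    pow_add _ (n + 1) k]
  ring

/-- For `x > 0`, with `q = e^{-πx}`,
`F_{(1,2)}(x) = -(π²/(32x)) (log q + 4 Σ_{k≥1} k χ₋₄(k) log(1+q^k))`. -/
theorem stmt_3 (x : ℝ) (hx : 0 < x) (q : ℝ) (hq : q = Real.exp (-π*x)) :
    Summable (fun k : ℕ => (k:ℝ) * chi4 k * Real.log (1 + q^k)) ∧
    F12 x = -(π^2/(32*x)) *
      (Real.log q + 4 * ∑' k : ℕ, (k:ℝ) * chi4 k * Real.log (1 + q^k)) := by
  have hq0 : 0 < q := hq ▸ Real.exp_pos _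
  have hq1 : q < 1 := by
    rw [hq, Real.exp_lt_one_iff]
    nlinarith [Real.pi_pos]
  have hlam := (summable_lambert hq0 hq1).hasSum
  have hlog := hlam.prod_fiberwise fun k => hasSum_lambert_log hq0 hq1 k
  have hswap := (Equiv.prodComm ℕ ℕ).hasSum_iff.2 hlam
  have hrows : HasSum (fun n : ℕ => ∑' k : ℕ, (k : ℝ) * chi4 k *
      ((-(q ^ k)) ^ (n + 1) / ((n : ℝ) + 1))) _ := hswap.prod_fiberwise fun n =>
    (hswap.summable.prod_factor n).hasSum
  have hlogs : Summable fun k : ℕ => (k:ℝ) * chi4 k * Real.log (1 + q^k) := by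
    simpa using hlog.summable.neg
  refine ⟨hlogs, ?_⟩
  have hval := hlog.unique hlogs.hasSum.neg
  rw [hval] at hrows
  have hlat := summable_lattice hx
  have hrow (n : ℕ) := hasSum_lattice_row_succ hx n (by
    refine ((hlat.prod_factor ((n : ℤ) + 1)).mul_left ((-1 : ℝ) ^ (n + 1))).congr fun k => ?_
    rw [show ((n : ℤ) + 1) + (k : ℤ) = ((n + 1 + k : ℕ) : ℤ) by push_cast; ring, zpow_natCast,
      pow_add _ (n + 1) k]
    have : ((-1 : ℝ) ^ (n + 1)) * (-1) ^ (n + 1) = 1 := by rw [← mul_pow]; simp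
    push_cast
    rw [mul_div_assoc', ← mul_assoc, ← mul_assoc, this, one_mul])
  rw [← hq] at hrow
  have hpos := hrows.mul_left (π ^ 2 / (16 * x))
  have hfib := hlat.hasSum.prod_fiberwise fun n => (hlat.prod_factor n).hasSum
  have hsumZ := HasSum.of_add_one_of_neg_add_one
    (f := fun n : ℤ => ∑' k : ℕ, (-1:ℝ)^(n + (k:ℤ)) * (2*(k:ℝ)+1) /
      ((2*(k:ℝ)+1)^2 + 4*x^2*(n:ℝ)^2)^2)
    (hpos.congr_fun fun n => by
      rw [← (hrow n).tsum_eq]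
      push_cast
      rfl)
    (hpos.congr_fun fun n => by
      rw [← (hrow n).tsum_eq]
      refine tsum_congr fun k => ?_
      have hsign : (-1 : ℝ) ^ (-((n : ℤ) + 1) + (k : ℤ)) = (-1) ^ ((n : ℤ) + 1 + (k : ℤ)) := by
        rw [zpow_add₀ (by norm_num), zpow_add₀ (by norm_num), zpow_neg, ← inv_zpow]
        norm_num
      rw [hsign]
      push_cast
      ring)
  rw [F12, hfib.unique hsumZ]
  have hzero : ∑' k : ℕ, (-1:ℝ)^((0 : ℤ) + (k:ℤ)) * (2*(k:ℝ)+1) /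
      ((2*(k:ℝ)+1)^2 + 4*x^2*((0 : ℤ):ℝ)^2)^2 = π ^ 3 / 32 := by
    simpa using hasSum_alternating_odd_cube.tsum_eq
  rw [hzero, show Real.log q = -π * x by rw [hq, Real.log_exp]]
  field_simp
  ring
end
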